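/- Let p ≡ 3 (mod 4) be a prime, p > 3. Define the matrix T over F_p by T = [(s_i+s_j)^{p-2} + (s_i-s_j)^{p-2}]_{1≤i,j≤(p-1)/2}, where s_1, ..., s_{(p-1)/2} are the nonzero squares in F_p (this corresponds to r = 1). Then det(T) = (-1)^{(p+3+2h(-p))/4} in F_p, where h(-p) is the class number of Q(√(-p)). -/

import Mathlib

theorem ZMod.choose_sub_two_eq {p : ℕ} [Fact p.Prime] {j : ℕ} (hj : j + 2 ≤ p) :
    ((p - 2).choose j : ZMod p) = (-1) ^ j * (j + 1) := by
  induction j with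
  | zero => simp
  | succ j ih =>
    have h := Nat.choose_succ_right_eq (p - 2) j
    have h' : ((p - 2).choose (j + 1) : ZMod p) * (j + 1) =
        (p - 2).choose j * ((p - 2 - j : ℕ) : ZMod p) := by exact_mod_cast congrArg _ h
    have hsub : ((p - 2 - j : ℕ) : ZMod p) = -(j + 2) := by
      rw [eq_neg_iff_add_eq_zero, ← CharP.cast_eq_zero (ZMod p) p]
      norm_cast
      congr 1
      omega
    have hne : ((j : ZMod p) + 1) ≠ 0 := by
      have : ((j + 1 : ℕ) : ZMod p) ≠ 0 := by
        rw [Ne, ZMod.natCast_eq_zero_iff]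
        exact fun hd => absurd (Nat.le_of_dvd (by omega) hd) (by omega)
      exact_mod_cast this
    rw [ih (by omega), hsub] at h'
    apply mul_right_cancel₀ hne
    rw [h']
    push_cast
    ring

theorem ZMod.sum_squares_pow {p n : ℕ} [Fact p.Prime] (hpn : p = 2 * n + 1) (hn : 0 < n)
    (s : Fin n → ZMod p) (hs : Function.Injective s)
    (hsimg : ∀ x : ZMod p, (∃ i, s i = x) ↔ ∃ y : ZMod p, y ≠ 0 ∧ y ^ 2 = x) (m : ℕ) :
    2 * ∑ i, s i ^ m = if n ∣ m then (-1 : ZMod p) else 0 := by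
  classical
  have hchar : ringChar (ZMod p) ≠ 2 := by rw [ZMod.ringChar_zmod_n]; omega
  have h1 : 2 * ∑ i, s i ^ m = ∑ x : (ZMod p)ˣ, (1 + (x : ZMod p) ^ n) * (x : ZMod p) ^ m := by
    have e1 : ∑ i, s i ^ m = ∑ x ∈ Finset.univ.image s, x ^ m := by
      rw [Finset.sum_image (fun a _ b _ h => hs h)]
    have e2 : Finset.univ.image s =
        (Finset.univ.filter fun x : (ZMod p)ˣ => IsSquare (x : ZMod p)).image
          (fun x : (ZMod p)ˣ => (x : ZMod p)) := by
      ext x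
      simp only [Finset.mem_image, Finset.mem_univ, true_and, Finset.mem_filter, hsimg]
      constructor
      · rintro ⟨y, hy, rfl⟩
        exact ⟨Units.mk0 (y ^ 2) (pow_ne_zero _ hy), ⟨y, by simp [sq]⟩, rfl⟩
      · rintro ⟨u, ⟨y, hy⟩, rfl⟩
        refine ⟨y, ?_, by rw [hy, sq]⟩
        rintro rfl
        simp at hy
    rw [e1, e2, Finset.sum_image (fun a _ b _ h => Units.ext h), Finset.mul_sum, Finset.sum_filter]
    refine Finset.sum_congr rfl fun x _ => ?_
    have h0 := quadraticChar_eq_pow_of_char_ne_two' hchar (x : ZMod p)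
    rw [ZMod.card, show p / 2 = n by omega] at h0
    rw [← h0, quadraticChar_apply, quadraticCharFun, if_neg x.ne_zero]
    split_ifs <;> norm_num
  rw [h1]
  simp_rw [add_mul, one_mul, ← pow_add]
  rw [Finset.sum_add_distrib, FiniteField.sum_pow_units, FiniteField.sum_pow_units, ZMod.card,
    show p - 1 = 2 * n by omega]
  by_cases hd : n ∣ m
  · obtain ⟨k, rfl⟩ := hd
    rw [if_pos (dvd_mul_right _ _)]
    have a1 : (2 * n ∣ n * k) ↔ 2 ∣ k := by
      rw [mul_comm 2 n]; exact Nat.mul_dvd_mul_iff_left hn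
    have a2 : (2 * n ∣ n + n * k) ↔ 2 ∣ (1 + k) := by
      rw [show n + n * k = n * (1 + k) by ring, mul_comm 2 n]; exact Nat.mul_dvd_mul_iff_left hn
    simp only [a1, a2]
    rcases Nat.even_or_odd' k with ⟨l, rfl | rfl⟩
    · rw [if_pos (by omega), if_neg (by omega)]; ring
    · rw [if_neg (by omega), if_pos (by omega)]; ring
  · have a1 : ¬ (2 * n ∣ m) := fun h => hd ((dvd_mul_left _ _).trans h)
    have a2 : ¬ (2 * n ∣ n + m) := fun h =>
      hd ((Nat.dvd_add_right (dvd_refl n)).1 ((dvd_mul_left _ _).trans h))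
    simp [a1, a2, hd]

theorem sum_add_pow_add_sub_pow {R : Type*} [CommRing R] (x y : R) (n : ℕ) :
    (x + y) ^ (2 * n + 1) + (x - y) ^ (2 * n + 1) =
      ∑ e ∈ Finset.range (n + 1),
        2 * ((2 * n + 1).choose (2 * e) : R) * x ^ (2 * n + 1 - 2 * e) * y ^ (2 * e) := by
  have key : ∀ (N : ℕ) (f : ℕ → R),
      ∑ m ∈ Finset.range (2 * N), f m = ∑ e ∈ Finset.range N, (f (2 * e) + f (2 * e + 1)) := by
    intro N f
    induction N with
    | zero => simp
    | succ N ih =>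
      rw [show 2 * (N + 1) = 2 * N + 1 + 1 by ring, Finset.sum_range_succ, Finset.sum_range_succ,
        ih, Finset.sum_range_succ]
      ring
  rw [add_comm x y, show x - y = -y + x by ring, add_pow, add_pow, ← Finset.sum_add_distrib,
    show 2 * n + 1 + 1 = 2 * (n + 1) by ring, key]
  refine Finset.sum_congr rfl fun e _ => ?_
  rw [Even.neg_pow ⟨e, by ring⟩, Odd.neg_pow ⟨e, by ring⟩]
  ring

theorem ZMod.prod_neg_odd {p n : ℕ} [Fact p.Prime] (hpn : p = 2 * n + 1) :
    ∏ e : Fin n, (-(2 * ((e : ℕ) : ZMod p) + 1)) = 2 ^ n * (n.factorial : ZMod p) := by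
  rw [Fin.prod_univ_eq_prod_range (fun e => (-(2 * (e : ZMod p) + 1))) n,
    ← Finset.prod_range_reflect]
  have h0 : (2 * n + 1 : ZMod p) = 0 := by
    rw [← CharP.cast_eq_zero (ZMod p) p]
    exact_mod_cast congrArg (Nat.cast (R := ZMod p)) hpn.symm
  have : ∀ j ∈ Finset.range n, (-(2 * ((n - 1 - j : ℕ) : ZMod p) + 1)) = 2 * ((j + 1 : ℕ)) := by
    intro j hj
    rw [Finset.mem_range] at hj
    have : ((n - 1 - j : ℕ) : ZMod p) = n - 1 - j := by
      rw [Nat.cast_sub (by omega), Nat.cast_sub (by omega)]; simp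
    rw [this]
    push_cast
    linear_combination -h0
  rw [Finset.prod_congr rfl this, Finset.prod_mul_distrib, Finset.prod_const, Finset.card_range,
    ← Finset.prod_range_add_one_eq_factorial]
  push_cast
  rfl

theorem Equiv.Perm.sign_addRight_of_odd {n : ℕ} [NeZero n] (hodd : Odd n) (c : Fin n) :
    Equiv.Perm.sign (Equiv.addRight c) = 1 := by
  have h : (Equiv.addRight c : Equiv.Perm (Fin n)) ^ n = 1 := by
    have hk : ∀ (k : ℕ) (x : Fin n), ((Equiv.addRight c : Equiv.Perm (Fin n)) ^ k) x = x + k • c := by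
      intro k x
      induction k with
      | zero => simp
      | succ k ih => rw [pow_succ', Equiv.Perm.mul_apply, ih, succ_nsmul, ← add_assoc]; rfl
    have hc : n • c = 0 := by
      simpa using card_nsmul_eq_zero' (x := c)
    ext x
    rw [hk, hc, add_zero, Equiv.Perm.one_apply]
  have h' := congrArg Equiv.Perm.sign h
  rw [map_pow, map_one] at h'
  rcases Int.units_eq_one_or (Equiv.Perm.sign (Equiv.addRight c)) with h1 | h1
  · exact h1
  · rw [h1, hodd.neg_one_pow] at h'
    exact absurd h' (by decide)

theorem det_squares_matrix {p n : ℕ} [Fact p.Prime] (hpn : p = 2 * n + 1) (hodd : Odd n)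
    (s : Fin n → ZMod p) (hs : Function.Injective s)
    (hsimg : ∀ x : ZMod p, (∃ i, s i = x) ↔ ∃ y : ZMod p, y ≠ 0 ∧ y ^ 2 = x) :
    (Matrix.of fun i j => (s i + s j) ^ (p - 2) + (s i - s j) ^ (p - 2)).det
      = 2 ^ n * (n.factorial : ZMod p) := by
  have hn : 0 < n := hodd.pos
  have : NeZero n := ⟨hn.ne'⟩
  let A : Matrix (Fin n) (Fin n) (ZMod p) := Matrix.of fun i e =>
    2 * ((p - 2).choose (2 * (e : ℕ)) : ZMod p) * s i ^ (p - 2 - 2 * (e : ℕ))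
  let B : Matrix (Fin n) (Fin n) (ZMod p) := Matrix.of fun e j => s j ^ (2 * (e : ℕ))
  have hT : (Matrix.of fun i j => (s i + s j) ^ (p - 2) + (s i - s j) ^ (p - 2)) = A * B := by
    ext i j
    simp only [A, B, Matrix.of_apply, Matrix.mul_apply]
    obtain ⟨k, rfl⟩ : ∃ k, n = k + 1 := ⟨n - 1, by omega⟩
    have : p - 2 = 2 * k + 1 := by omega
    simp only [this]
    rw [sum_add_pow_add_sub_pow]
    exact (Fin.sum_univ_eq_sum_range (fun e => 2 * ((2 * k + 1).choose (2 * e) : ZMod p) *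
      s i ^ (2 * k + 1 - 2 * e) * s j ^ (2 * e)) (k + 1)).symm
  let c : Fin n := ⟨(n - 1) / 2, by omega⟩
  have hBA : B * A = Matrix.of fun i j : Fin n => (-(2 * ((j : ℕ) : ZMod p) + 1)) *
      (Equiv.Perm.permMatrix (ZMod p) (Equiv.addRight c)) i j := by
    ext e e'
    simp only [A, B, Matrix.of_apply, Matrix.mul_apply]
    have h1 : ∀ j, s j ^ (2 * (e : ℕ)) * (2 * ((p - 2).choose (2 * (e' : ℕ)) : ZMod p) *
        s j ^ (p - 2 - 2 * (e' : ℕ))) = ((p - 2).choose (2 * (e' : ℕ)) : ZMod p) *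
          (2 * s j ^ (2 * (e : ℕ) + (p - 2 - 2 * (e' : ℕ)))) := by
      intro j; rw [pow_add]; ring
    simp_rw [h1]
    rw [← Finset.mul_sum, ← Finset.mul_sum, ZMod.sum_squares_pow hpn hn s hs hsimg,
      ZMod.choose_sub_two_eq (by omega)]
    have h2 : n ∣ 2 * (e : ℕ) + (p - 2 - 2 * (e' : ℕ)) ↔ e + c = e' := by
      obtain ⟨k, hk⟩ := hodd
      have hc : (c : ℕ) = k := by simp only [c]; omega
      rw [Fin.ext_iff, Fin.val_add, hc]
      have hm := Nat.mod_add_div ((e : ℕ) + k) n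
      have hlt := Nat.mod_lt ((e : ℕ) + k) hn
      have he := e.2
      have he' := e'.2
      constructor
      · rintro ⟨d, hd⟩
        have hd4 : d < 4 := by
          by_contra h
          have : n * 4 ≤ n * d := Nat.mul_le_mul_left _ (by omega)
          omega
        have hq : ((e : ℕ) + k) / n < 2 := Nat.div_lt_of_lt_mul (by omega)
        interval_cases d <;> interval_cases ((e : ℕ) + k) / n <;> omega
      · intro h
        have hq : ((e : ℕ) + k) / n < 2 := Nat.div_lt_of_lt_mul (by omega)
        rw [h] at hm
        interval_cases ((e : ℕ) + k) / n
        · exact ⟨1, by omega⟩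
        · exact ⟨3, by omega⟩
    have h3 : Equiv.Perm.permMatrix (ZMod p) (Equiv.addRight c) e e' =
        if e + c = e' then 1 else 0 := by
      simp [Equiv.Perm.permMatrix, PEquiv.toMatrix_apply, Equiv.toPEquiv_apply, eq_comm]
    rw [h3, pow_mul]
    simp only [h2]
    split_ifs <;> push_cast <;> ring
  rw [hT, Matrix.det_mul_comm, hBA, Matrix.det_mul_row, Matrix.det_permutation,
    Equiv.Perm.sign_addRight_of_odd hodd, ZMod.prod_neg_odd hpn]
  simp

theorem ZMod.factorial_half_sq {p n : ℕ} [Fact p.Prime] (hpn : p = 2 * n + 1) (hodd : Odd n) :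
    (n.factorial : ZMod p) ^ 2 = 1 := by
  have h := ZMod.wilsons_lemma p
  rw [show p - 1 = n + n by omega, ← Nat.factorial_mul_ascFactorial, Nat.ascFactorial_eq_prod_range] at h
  push_cast at h
  rw [← Finset.prod_range_reflect] at h
  have h1 : ∀ j ∈ Finset.range n, ((n : ZMod p) + 1 + ((n - 1 - j : ℕ) : ZMod p)) =
      -1 * ((j + 1 : ℕ) : ZMod p) := by
    intro j hj
    rw [Finset.mem_range] at hj
    have h0 : (2 * n + 1 : ZMod p) = 0 := by
      rw [← CharP.cast_eq_zero (ZMod p) p]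
      exact_mod_cast congrArg (Nat.cast (R := ZMod p)) hpn.symm
    have : ((n - 1 - j : ℕ) : ZMod p) = n - 1 - j := by
      rw [Nat.cast_sub (by omega), Nat.cast_sub (by omega)]; simp
    rw [this]
    push_cast
    linear_combination h0
  rw [Finset.prod_congr rfl h1, Finset.prod_mul_distrib, Finset.prod_const, Finset.card_range,
    hodd.neg_one_pow] at h
  have h2 : ∏ j ∈ Finset.range n, ((j + 1 : ℕ) : ZMod p) = n.factorial := by
    rw [← Finset.prod_range_add_one_eq_factorial]; push_cast; rfl
  rw [h2] at h
  linear_combination -h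

theorem ZMod.factorial_half_eq_prod {p n : ℕ} [Fact p.Prime] (hpn : p = 2 * n + 1) (hodd : Odd n) :
    (n.factorial : ZMod p) =
      ((∏ k ∈ Finset.range n, quadraticChar (ZMod p) ((k + 1 : ℕ) : ZMod p) : ℤ) : ZMod p) := by
  have hn := hodd.pos
  have hchar : ringChar (ZMod p) ≠ 2 := by rw [ZMod.ringChar_zmod_n]; omega
  have h0 := quadraticChar_eq_pow_of_char_ne_two' hchar (n.factorial : ZMod p)
  rw [ZMod.card, show p / 2 = n by omega] at h0
  obtain ⟨k, rfl⟩ := hodd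
  rw [pow_succ, pow_mul, ZMod.factorial_half_sq hpn ⟨k, rfl⟩, one_pow, one_mul] at h0
  rw [← h0, ← Finset.prod_range_add_one_eq_factorial]
  push_cast [map_prod]
  rfl

theorem four_dvd_sum_sub_card_add_one_sub_prod (n : ℕ) (f : ℕ → ℤ)
    (hf : ∀ k < n, f k = 1 ∨ f k = -1) :
    (∏ k ∈ Finset.range n, f k = 1 ∨ ∏ k ∈ Finset.range n, f k = -1) ∧
    (4 : ℤ) ∣ (∑ k ∈ Finset.range n, f k) - n + 1 - ∏ k ∈ Finset.range n, f k := by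
  induction n with
  | zero => simp
  | succ n ih =>
    obtain ⟨h1, h2⟩ := ih fun k hk => hf k (by omega)
    rw [Finset.sum_range_succ, Finset.prod_range_succ]
    push_cast
    rcases h1 with h1 | h1 <;> rcases hf n (by omega) with h3 | h3 <;> rw [h1] at h2 ⊢ <;> rw [h3]
      <;> constructor <;> omega

theorem two_pow_mul_factorial_eq_of_classNumber_formula {p n h : ℕ} [Fact p.Prime]
    (hpn : p = 2 * n + 1) (hodd : Odd n)
    (hh : (h : ℤ) * (2 - quadraticChar (ZMod p) 2) =
      ∑ k ∈ Finset.range n, quadraticChar (ZMod p) ((k + 1 : ℕ) : ZMod p)) :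
    (2 ^ n * n.factorial : ZMod p) = (-1) ^ ((p + 3 + 2 * h) / 4) := by
  have hn := hodd.pos
  have hchar : ringChar (ZMod p) ≠ 2 := by rw [ZMod.ringChar_zmod_n]; omega
  have h0 := quadraticChar_eq_pow_of_char_ne_two' hchar (2 : ZMod p)
  rw [ZMod.card, show p / 2 = n by omega] at h0
  obtain ⟨h1, h2⟩ := four_dvd_sum_sub_card_add_one_sub_prod n
    (fun k => quadraticChar (ZMod p) ((k + 1 : ℕ) : ZMod p)) (by
      intro k hk
      apply quadraticChar_dichotomy
      rw [Ne, ZMod.natCast_eq_zero_iff]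
      exact fun hd => absurd (Nat.le_of_dvd (by omega) hd) (by omega))
  rw [← hh] at h2
  rw [← h0, ZMod.factorial_half_eq_prod hpn hodd]
  have hχ2 := quadraticChar_two hchar
  rw [ZMod.card, ZMod.χ₈_nat_eq_if_mod_eight, if_neg (by omega)] at hχ2
  obtain ⟨k, hk⟩ := hodd
  have hpar : ∀ {e : ℕ} {z : ℤ}, (z = 1 ∧ e % 2 = 0) ∨ (z = -1 ∧ e % 2 = 1) →
      (z : ZMod p) = (-1) ^ e := by
    rintro e z (⟨rfl, he⟩ | ⟨rfl, he⟩)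
    · rw [Even.neg_one_pow (Nat.even_iff.2 he)]; simp
    · rw [Odd.neg_one_pow (Nat.odd_iff.2 he)]; simp
  rw [← Int.cast_mul]
  apply hpar
  split_ifs at hχ2 with h8 <;> rw [hχ2] at h2 ⊢ <;> rcases h1 with h1 | h1 <;>
    rw [h1] at h2 ⊢ <;> omega

open Polynomial in
theorem Polynomial.eval_one_iterate_X_mul_derivative {R : Type*} [CommRing R] (k r : ℕ) (G : R[X]) :
    eval 1 ((fun P : R[X] => X * derivative P)^[k] ((X - 1) ^ (k + r) * G)) =
      if r = 0 then k.factorial * eval 1 G else 0 := by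
  induction k generalizing G with
  | zero =>
    by_cases hr : r = 0 <;> simp [hr]
  | succ k ih =>
    rw [Function.iterate_succ_apply]
    have : X * derivative ((X - 1) ^ (k + 1 + r) * G) = (X - 1) ^ (k + r) *
        (((k + 1 + r : ℕ) : R[X]) * X * G + (X - 1) * X * derivative G) := by
      rw [show k + 1 + r = (k + r) + 1 by ring, derivative_mul, derivative_pow]
      simp
      ring
    rw [this, ih]
    split_ifs with h
    · subst h
      simp [Nat.factorial_succ]
      ring
    · rfl

open Polynomial in
theorem Polynomial.eval_one_iterate_X_mul_derivative_sum {R ι : Type*} [CommRing R] (k : ℕ)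
    (s : Finset ι) (c : ι → R) (d : ι → ℕ) :
    eval 1 ((fun P : R[X] => X * derivative P)^[k] (∑ i ∈ s, C (c i) * X ^ d i)) =
      ∑ i ∈ s, c i * (d i : R) ^ k := by
  have : (fun P : R[X] => X * derivative P)^[k] (∑ i ∈ s, C (c i) * X ^ d i) =
      ∑ i ∈ s, C (c i * (d i : R) ^ k) * X ^ d i := by
    induction k with
    | zero => simp
    | succ k ih =>
      rw [Function.iterate_succ_apply', ih, derivative_sum, Finset.mul_sum]
      refine Finset.sum_congr rfl fun i _ => ?_
      rw [derivative_C_mul_X_pow]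
      rcases Nat.eq_zero_or_pos (d i) with h | h
      · simp [h]
      · obtain ⟨m, hm⟩ : ∃ m, d i = m + 1 := ⟨d i - 1, by omega⟩
        rw [hm, pow_succ X]
        simp
        ring
  rw [this]
  simp [eval_finsetSum]

open Polynomial in
theorem Polynomial.iterate_X_mul_derivative_add {R : Type*} [CommRing R] (k : ℕ) (P Q : R[X]) :
    (fun P : R[X] => X * derivative P)^[k] (P + Q) =
      (fun P : R[X] => X * derivative P)^[k] P + (fun P : R[X] => X * derivative P)^[k] Q := by
  induction k generalizing P Q with
  | zero => rfl
  | succ k ih => simp only [Function.iterate_succ_apply, derivative_add, mul_add, ih]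

theorem Complex.norm_one_sub_exp_two_pi {p k : ℕ} (hk : k ≤ p) (hp : 0 < p) :
    ‖1 - Complex.exp (2 * Real.pi * Complex.I / p) ^ k‖ = 2 * Real.sin (Real.pi * k / p) := by
  have hp' : (0 : ℝ) < p := by exact_mod_cast hp
  rw [← Complex.exp_nat_mul, norm_sub_rev,
    show (k : ℂ) * (2 * Real.pi * Complex.I / p) = Complex.I * ((2 * Real.pi * k / p : ℝ) : ℂ) by
      push_cast; ring, Complex.norm_exp_I_mul_ofReal_sub_one, Real.norm_eq_abs, abs_of_nonneg]
  · congr 2; ring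
  · apply mul_nonneg zero_le_two
    apply Real.sin_nonneg_of_nonneg_of_le_pi
    · positivity
    · rw [show 2 * Real.pi * k / p / 2 = Real.pi * (k / p) by ring]
      have : (k : ℝ) / p ≤ 1 := by rw [div_le_one hp']; exact_mod_cast hk
      nlinarith [Real.pi_pos]

theorem Real.prod_two_mul_sin {p n : ℕ} (hpn : p = 2 * n + 1) :
    ∏ k ∈ Finset.range n, (2 * Real.sin (Real.pi * (k + 1 : ℕ) / p)) = √p := by
  have hp' : (0 : ℝ) < p := by rw [hpn]; positivity
  have h := (Complex.isPrimitiveRoot_exp p (by omega))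
  have h1 : (∏ k ∈ Finset.range (n + n),
      (1 - Complex.exp (2 * Real.pi * Complex.I / p) ^ (k + 1))) = p := by
    have h2 := IsPrimitiveRoot.prod_one_sub_pow_eq_order (n := 2 * n) (by rw [← hpn]; exact h)
    rw [two_mul] at h2
    rw [h2, hpn]; push_cast; ring
  have h3 := congrArg (fun z : ℂ => ‖z‖) h1
  beta_reduce at h3
  rw [norm_prod, Complex.norm_natCast] at h3
  rw [Finset.prod_congr rfl fun k hk => Complex.norm_one_sub_exp_two_pi
    (by rw [Finset.mem_range] at hk; omega) (by omega), Finset.prod_range_add,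
    ← Finset.prod_range_reflect (fun x => 2 * Real.sin (Real.pi * (n + x + 1 : ℕ) / p)),
    ← Finset.prod_mul_distrib] at h3
  symm
  rw [Real.sqrt_eq_iff_mul_self_eq hp'.le]
  · rw [← Finset.prod_mul_distrib]
    refine Eq.trans h3.symm ?_
    refine Finset.prod_congr rfl fun k hk => ?_
    rw [Finset.mem_range] at hk
    congr 2
    rw [← Real.sin_pi_sub (Real.pi * (k + 1 : ℕ) / p)]
    congr 1
    have : ((n + (n - 1 - k) + 1 : ℕ) : ℝ) = p - (k + 1 : ℕ) := by
      rw [eq_sub_iff_add_eq]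
      norm_cast
      omega
    rw [this]
    field_simp
  · refine Finset.prod_nonneg fun k hk => ?_
    rw [Finset.mem_range] at hk
    rw [← Complex.norm_one_sub_exp_two_pi (by omega) (by omega)]
    positivity

theorem Complex.I_mul_sqrt_eq_prod {p n : ℕ} (hpn : p = 2 * n + 1) (hodd : Odd n) :
    ∃ e : ℕ, Complex.I * ((√(p : ℝ) : ℝ) : ℂ) = -Complex.exp (2 * Real.pi * Complex.I / p) ^ e *
      ∏ k ∈ Finset.range n, (Complex.exp (2 * Real.pi * Complex.I / p) ^ (k + 1) - 1) := by
  have hp' : (p : ℂ) ≠ 0 := by exact_mod_cast (by omega : p ≠ 0)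
  set ζ := Complex.exp (2 * Real.pi * Complex.I / p) with hζ
  refine ⟨∑ k ∈ Finset.range n, n * (k + 1), ?_⟩
  have hfac : ∀ k : ℕ, Complex.I * ((2 * Real.sin (Real.pi * (k + 1 : ℕ) / p) : ℝ) : ℂ) =
      (-1) ^ (k + 1) * ζ ^ (n * (k + 1)) * (ζ ^ (k + 1) - 1) := by
    intro k
    have e1 : (-1 : ℂ) ^ (k + 1) * ζ ^ (n * (k + 1)) =
        Complex.exp (-(Real.pi * (k + 1) / p) * Complex.I) := by
      rw [← Complex.exp_pi_mul_I, hζ, ← Complex.exp_nat_mul, ← Complex.exp_nat_mul,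
        ← Complex.exp_add]
      have : Complex.exp (-(Real.pi * (k + 1) / p) * Complex.I) =
          Complex.exp (-(Real.pi * (k + 1) / p) * Complex.I + (k + 1 : ℕ) * (2 * Real.pi * Complex.I)) := by
        rw [Complex.exp_add, Complex.exp_nat_mul_two_pi_mul_I, mul_one]
      rw [this]
      congr 1
      have hp2 : (p : ℂ) = 2 * n + 1 := by rw [hpn]; push_cast; ring
      field_simp
      rw [hp2]
      push_cast
      ring
    have e2 : ζ ^ (k + 1) = Complex.exp (2 * (Real.pi * (k + 1) / p * Complex.I)) := by
      rw [hζ, ← Complex.exp_nat_mul]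
      congr 1
      push_cast
      ring
    rw [e1, e2]
    push_cast
    rw [Complex.two_sin, mul_sub, ← Complex.exp_add]
    have : -(Real.pi * (k + 1) / p : ℂ) * Complex.I + 2 * (Real.pi * (k + 1) / p * Complex.I) =
      (Real.pi * (k + 1) / p) * Complex.I := by ring
    rw [this]
    linear_combination (Complex.exp (-(Real.pi * (k + 1) / p) * Complex.I) -
      Complex.exp ((Real.pi * (k + 1) / p) * Complex.I)) * Complex.I_mul_I
  have hprod := Finset.prod_congr (rfl : Finset.range n = Finset.range n) fun k _ => hfac k
  rw [Finset.prod_mul_distrib, Finset.prod_mul_distrib, Finset.prod_mul_distrib,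
    Finset.prod_const, Finset.card_range, ← Complex.ofReal_prod, Real.prod_two_mul_sin hpn,
    Finset.prod_pow_eq_pow_sum _ _ ζ] at hprod
  obtain ⟨t, rfl⟩ := hodd
  have hsign : ∏ k ∈ Finset.range (2 * t + 1), (-1 : ℂ) ^ (k + 1) = (-1) ^ (t + 1) := by
    clear * -
    induction t with
    | zero => simp
    | succ t ih =>
      rw [show 2 * (t + 1) + 1 = 2 * t + 1 + 1 + 1 by ring, Finset.prod_range_succ,
        Finset.prod_range_succ, ih,
        Odd.neg_one_pow (n := 2 * t + 1 + 1 + 1) ⟨t + 1, by ring⟩,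
        Even.neg_one_pow (n := 2 * t + 1 + 1) ⟨t + 1, by ring⟩]
      ring
  rw [hsign, pow_succ Complex.I, pow_mul, Complex.I_sq] at hprod
  have h1 : ((-1 : ℂ) ^ t) * (-1) ^ t = 1 := by rw [← mul_pow]; simp
  rw [pow_succ (-1 : ℂ) t] at hprod
  linear_combination (-1 : ℂ) ^ t * hprod +
    (-(Complex.I * ((√(p : ℝ) : ℝ) : ℂ)) - ζ ^ (∑ k ∈ Finset.range (2 * t + 1), (2 * t + 1) * (k + 1)) *
      ∏ k ∈ Finset.range (2 * t + 1), (ζ ^ (k + 1) - 1)) * h1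

open Polynomial in
/-- The sign of the quadratic Gauss sum for primes `p ≡ 3 (mod 4)`. -/
theorem gaussSum_quadraticChar_eq_I_mul_sqrt {p n : ℕ} [Fact p.Prime] (hpn : p = 2 * n + 1)
    (hodd : Odd n) :
    gaussSum ((quadraticChar (ZMod p)).ringHomComp (Int.castRingHom ℂ)) ZMod.stdAddChar =
      Complex.I * ((√(p : ℝ) : ℝ) : ℂ) := by
  have hn := hodd.pos
  have hchar : ringChar (ZMod p) ≠ 2 := by rw [ZMod.ringChar_zmod_n]; omega
  set ζ := Complex.exp (2 * Real.pi * Complex.I / p) with hζ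
  have hprim : IsPrimitiveRoot ζ p := Complex.isPrimitiveRoot_exp p (by omega)
  obtain ⟨e, he⟩ := Complex.I_mul_sqrt_eq_prod hpn hodd
  rw [← hζ] at he
  have hneg : quadraticChar (ZMod p) (-1) = -1 := by
    rw [quadraticChar_neg_one hchar, ZMod.card, ZMod.χ₄_nat_three_mod_four]
    obtain ⟨k, rfl⟩ := hodd
    omega
  have hsq : gaussSum ((quadraticChar (ZMod p)).ringHomComp (Int.castRingHom ℂ)) ZMod.stdAddChar ^ 2
      = (Complex.I * ((√(p : ℝ) : ℝ) : ℂ)) ^ 2 := by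
    rw [gaussSum_sq ?_ ((quadraticChar_isQuadratic (ZMod p)).comp _) (ZMod.isPrimitive_stdAddChar p),
      MulChar.ringHomComp_apply, hneg, mul_pow, ← Complex.ofReal_pow,
      Real.sq_sqrt (Nat.cast_nonneg p), ZMod.card]
    · simp
    · rw [MulChar.ringHomComp_ne_one_iff (RingHom.injective_int _)]
      exact quadraticChar_ne_one hchar
  obtain ⟨ε, hε, hsum⟩ : ∃ ε : ℤ, (ε = 1 ∨ ε = -1) ∧
      gaussSum ((quadraticChar (ZMod p)).ringHomComp (Int.castRingHom ℂ)) ZMod.stdAddChar =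
      ε * (Complex.I * ((√(p : ℝ) : ℝ) : ℂ)) := by
    rcases sq_eq_sq_iff_eq_or_eq_neg.1 hsq with h | h
    · exact ⟨1, Or.inl rfl, by simpa using h⟩
    · exact ⟨-1, Or.inr rfl, by simpa using h⟩
  let F : ℤ[X] := (∑ a : ZMod p, C (quadraticChar (ZMod p) a) * X ^ a.val) +
    C ε * X ^ e * ∏ k ∈ Finset.range n, (X ^ (k + 1) - 1)
  have hF : aeval ζ F = 0 := by
    have h1 : gaussSum ((quadraticChar (ZMod p)).ringHomComp (Int.castRingHom ℂ)) ZMod.stdAddChar =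
        aeval ζ (∑ a : ZMod p, C (quadraticChar (ZMod p) a) * X ^ a.val : ℤ[X]) := by
      rw [gaussSum, map_sum]
      refine Finset.sum_congr rfl fun a _ => ?_
      rw [MulChar.ringHomComp_apply, ZMod.stdAddChar_apply, ZMod.toCircle_apply, map_mul, aeval_C,
        map_pow, aeval_X, hζ, ← Complex.exp_nat_mul]
      congr 2
      ring
    rw [map_add, ← h1, hsum, he]
    simp [map_prod]
    ring
  have hdvd : cyclotomic p ℤ ∣ F := by
    rw [cyclotomic_eq_minpoly hprim (by omega)]
    exact minpoly.isIntegrallyClosed_dvd (hprim.isIntegral (by omega)) hF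
  have hdvd' := Polynomial.map_dvd (Int.castRingHom (ZMod p)) hdvd
  have hcyc : cyclotomic p (ZMod p) = (X - 1) ^ (2 * n) := by
    have := cyclotomic_mul_prime_pow_eq (ZMod p) (p := p) (m := 1)
      (fun h => (Fact.out : p.Prime).one_lt.ne' (Nat.dvd_one.1 h)) (k := 1) one_pos
    simp only [pow_one, mul_one, cyclotomic_one, Nat.sub_self, pow_zero] at this
    rw [this]
    congr 1
    omega
  rw [map_cyclotomic, hcyc] at hdvd'
  obtain ⟨G, hG⟩ := hdvd'
  have hev := congrArg (fun P => eval 1 ((fun P : (ZMod p)[X] => X * derivative P)^[n] P)) hG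
  beta_reduce at hev
  rw [show 2 * n = n + n by ring, eval_one_iterate_X_mul_derivative, if_neg hn.ne'] at hev
  have hmap : F.map (Int.castRingHom (ZMod p)) =
      (∑ a : ZMod p, C ((quadraticChar (ZMod p) a : ℤ) : ZMod p) * X ^ a.val) +
      (X - 1) ^ (n + 0) * (C (ε : ZMod p) * X ^ e *
        ∏ k ∈ Finset.range n, ∑ i ∈ Finset.range (k + 1), X ^ i) := by
    have : (∏ k ∈ Finset.range n, (X ^ (k + 1) - 1) : (ZMod p)[X]) = (X - 1) ^ n *
        ∏ k ∈ Finset.range n, ∑ i ∈ Finset.range (k + 1), X ^ i := by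
      rw [← Finset.card_range n, ← Finset.prod_const, Finset.card_range, ← Finset.prod_mul_distrib]
      exact Finset.prod_congr rfl fun k _ => by rw [mul_comm, geom_sum_mul]
    simp only [F, Polynomial.map_add, Polynomial.map_mul, Polynomial.map_sum, Polynomial.map_pow,
      Polynomial.map_prod, Polynomial.map_sub, map_X, Polynomial.map_one, map_C, this]
    simp
    ring
  rw [hmap, iterate_X_mul_derivative_add, eval_add, eval_one_iterate_X_mul_derivative_sum,
    eval_one_iterate_X_mul_derivative, if_pos rfl] at hev
  have hG1 : eval 1 (C (ε : ZMod p) * X ^ e *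
        ∏ k ∈ Finset.range n, ∑ i ∈ Finset.range (k + 1), X ^ i : (ZMod p)[X]) =
      (ε : ZMod p) * (n.factorial : ZMod p) := by
    simp [eval_prod, eval_finsetSum, ← Finset.prod_range_add_one_eq_factorial]
  have hchi : ∑ a : ZMod p, ((quadraticChar (ZMod p) a : ℤ) : ZMod p) * ((a.val : ℕ) : ZMod p) ^ n
      = -1 := by
    have h1 : ∀ a : ZMod p, ((quadraticChar (ZMod p) a : ℤ) : ZMod p) * ((a.val : ℕ) : ZMod p) ^ n
        = 1 - if a = 0 then 1 else 0 := by
      intro a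
      have h0 := quadraticChar_eq_pow_of_char_ne_two' hchar a
      rw [ZMod.card, show p / 2 = n by omega] at h0
      rw [ZMod.natCast_zmod_val, ← h0, ← Int.cast_mul, ← sq]
      split_ifs with h
      · simp [h]
      · rw [quadraticChar_sq_one h]; simp
    rw [Finset.sum_congr rfl fun a _ => h1 a, Finset.sum_sub_distrib]
    simp
  rw [hG1, hchi] at hev
  have hfac := ZMod.factorial_half_sq hpn hodd
  have hε1 : (ε : ZMod p) = 1 := by linear_combination hev - ε * hfac
  rcases hε with rfl | rfl
  · simpa using hsum
  · exfalso
    have h2 : ((2 : ℕ) : ZMod p) = 0 := by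
      push_cast at hε1 ⊢
      linear_combination -hε1
    rw [ZMod.natCast_eq_zero_iff] at h2
    exact absurd (Nat.le_of_dvd two_pos h2) (by omega)

open HurwitzZeta Filter Topology in
lemma abs_rpow_neg_sub_rpow_neg_le {x y s m N : ℝ} (hxy : x ≤ y) (hyx : y ≤ x + 1) (hs1 : 1 ≤ s)
    (hs2 : s ≤ 2) (hm : 0 < m) (hm1 : m ≤ 1) (hN : 1 ≤ N) (hx : m * N ≤ x) :
    |x ^ (-s) - y ^ (-s)| ≤ 2 / m ^ 3 / N ^ 2 := by
  have hmN : 0 < m * N := by positivity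
  have hx0 : 0 < x := by linarith
  have hy0 : 0 < y := by linarith
  have h1 : y ^ (-s) = x ^ (-s) * (x / y) ^ s := by
    rw [Real.div_rpow hx0.le hy0.le, Real.rpow_neg hx0.le, Real.rpow_neg hy0.le]
    have := (Real.rpow_pos_of_pos hx0 s).ne'
    field_simp
  have hq1 : x / y ≤ 1 := (div_le_one hy0).2 hxy
  have h2 : (x / y) ^ 2 ≤ (x / y) ^ s := by
    rw [← Real.rpow_two]
    exact Real.rpow_le_rpow_of_exponent_ge (by positivity) hq1 hs2
  have h3 : (x / y) ^ s ≤ 1 := Real.rpow_le_one (by positivity) hq1 (by linarith)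
  have h4 : x ^ (-s) ≤ 1 / (m ^ 2 * N) := by
    rw [Real.rpow_neg hx0.le, ← one_div]
    refine one_div_le_one_div_of_le (by positivity) ?_
    calc m ^ 2 * N ≤ m ^ s * N ^ s := by
          gcongr
          · rw [← Real.rpow_two]
            exact Real.rpow_le_rpow_of_exponent_ge hm hm1 hs2
          · exact Real.self_le_rpow_of_one_le hN hs1
      _ = (m * N) ^ s := (Real.mul_rpow hm.le (by linarith)).symm
      _ ≤ x ^ s := Real.rpow_le_rpow hmN.le hx (by linarith)
  have h5 : 1 - (x / y) ^ 2 ≤ 2 / (m * N) := by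
    have : 1 - (x / y) ^ 2 = (1 - x / y) * (1 + x / y) := by ring
    have h6 : 1 - x / y ≤ 1 / (m * N) := by
      calc 1 - x / y = (y - x) / y := by field_simp
        _ ≤ 1 / (m * N) := by gcongr <;> linarith
    have h7 : 0 ≤ 1 - x / y := by linarith
    rw [this]
    calc (1 - x / y) * (1 + x / y) ≤ 1 / (m * N) * 2 := by gcongr; linarith
      _ = 2 / (m * N) := by ring
  have h8 : 0 ≤ x ^ (-s) := by positivity
  rw [h1, abs_of_nonneg (by nlinarith)]
  calc x ^ (-s) - x ^ (-s) * (x / y) ^ s = x ^ (-s) * (1 - (x / y) ^ s) := by ring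
    _ ≤ 1 / (m ^ 2 * N) * (2 / (m * N)) := by
        gcongr
        linarith
    _ = 2 / m ^ 3 / N ^ 2 := by field_simp

open HurwitzZeta Filter Topology in
/-- The odd Hurwitz zeta function at `1`, as an absolutely convergent series. -/
lemma HurwitzZeta.hasSum_hurwitzZetaOdd_one {a : ℝ} (ha0 : 0 < a) (ha1 : a < 1) :
    HasSum (fun n : ℕ => ((1 / (n + a) - 1 / (n + 1 - a)) / 2 : ℂ))
      (hurwitzZetaOdd (a : UnitAddCircle) 1) := by
  set g : ℝ → ℕ → ℝ := fun s n => ((n + a) ^ (-s) - (n + 1 - a) ^ (-s)) / 2 with hg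
  set m : ℝ := min a (1 - a) with hm
  have hm0 : 0 < m := lt_min ha0 (by linarith)
  have hma : m ≤ a := min_le_left _ _
  have hma' : m ≤ 1 - a := min_le_right _ _
  have hbound : ∀ s ∈ Set.Icc (1 : ℝ) 2, ∀ n : ℕ, ‖g s n‖ ≤ 2 / m ^ 3 / ((n : ℝ) + 1) ^ 2 := by
    intro s hs n
    have hn : (0 : ℝ) ≤ n := n.cast_nonneg
    have hB : 0 ≤ 2 / m ^ 3 / ((n : ℝ) + 1) ^ 2 := by positivity
    have hmn : m * n ≤ n := by nlinarith
    have key : |((n : ℝ) + a) ^ (-s) - (n + 1 - a) ^ (-s)| ≤ 2 / m ^ 3 / ((n : ℝ) + 1) ^ 2 := by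
      rcases le_total ((n : ℝ) + a) (n + 1 - a) with h | h
      · exact abs_rpow_neg_sub_rpow_neg_le h (by linarith) hs.1 hs.2 hm0 (by linarith)
          (by linarith) (by nlinarith)
      · rw [abs_sub_comm]
        exact abs_rpow_neg_sub_rpow_neg_le h (by linarith) hs.1 hs.2 hm0 (by linarith)
          (by linarith) (by nlinarith)
    rw [Real.norm_eq_abs, hg, abs_div, abs_two]
    linarith
  have hsummable : Summable fun n : ℕ => 2 / m ^ 3 / ((n : ℝ) + 1) ^ 2 := by
    simp_rw [div_eq_mul_one_div (2 / m ^ 3)]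
    refine Summable.mul_left _ ?_
    exact_mod_cast (summable_nat_add_iff 1).2 (Real.summable_one_div_nat_pow.2 one_lt_two)
  have hlim : Tendsto (fun s : ℝ => ∑' n, g s n) (𝓝[>] 1) (𝓝 (∑' n, g 1 n)) := by
    refine tendsto_tsum_of_dominated_convergence hsummable (fun n => ?_) ?_
    · have hn : (0 : ℝ) ≤ n := n.cast_nonneg
      refine (ContinuousAt.tendsto ?_).mono_left nhdsWithin_le_nhds
      simp only [hg]
      have h1 : (n : ℝ) + a ≠ 0 := by linarith
      have h2 : (n : ℝ) + 1 - a ≠ 0 := by linarith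
      exact ((continuousAt_const.rpow continuousAt_neg (Or.inl h1)).sub
        (continuousAt_const.rpow continuousAt_neg (Or.inl h2))).div_const 2
    · filter_upwards [Ioo_mem_nhdsGT (one_lt_two)] with s hs
      exact hbound s ⟨hs.1.le, hs.2.le⟩
  have heq : ∀ s : ℝ, 1 < s →
      hurwitzZetaOdd (a : UnitAddCircle) (s : ℂ) = ((∑' n, g s n : ℝ) : ℂ) := by
    intro s hs
    rw [← (hasSum_nat_hurwitzZetaOdd a (s := s) (by simpa using hs)).tsum_eq, Complex.ofReal_tsum]
    refine tsum_congr fun n => ?_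
    have hn : (0 : ℝ) ≤ n := n.cast_nonneg
    have h1 : 0 < (n : ℝ) + a := by linarith
    have h2 : 0 < (n : ℝ) + 1 - a := by linarith
    simp only [hg]
    rw [abs_of_pos h1, abs_of_pos h2, sign_pos h1, sign_pos h2, Real.rpow_neg h1.le,
      Real.rpow_neg h2.le]
    push_cast
    rw [Complex.ofReal_cpow h1.le, Complex.ofReal_cpow h2.le]
    simp
  have hcont : Tendsto (fun s : ℝ => hurwitzZetaOdd (a : UnitAddCircle) (s : ℂ)) (𝓝[>] 1)
      (𝓝 (hurwitzZetaOdd (a : UnitAddCircle) 1)) := by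
    have : Continuous fun s : ℝ => hurwitzZetaOdd (a : UnitAddCircle) (s : ℂ) :=
      (differentiable_hurwitzZetaOdd _).continuous.comp Complex.continuous_ofReal
    simpa using (this.tendsto 1).mono_left nhdsWithin_le_nhds
  have hcont' : Tendsto (fun s : ℝ => hurwitzZetaOdd (a : UnitAddCircle) (s : ℂ)) (𝓝[>] 1)
      (𝓝 ((∑' n, g 1 n : ℝ) : ℂ)) := by
    refine ((Complex.continuous_ofReal.tendsto _).comp hlim).congr' ?_
    filter_upwards [self_mem_nhdsWithin] with s hs
    exact (heq s hs).symm
  rw [tendsto_nhds_unique hcont hcont']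
  have hsum1 : Summable (g 1) := hsummable.of_norm_bounded (hbound 1 (by simp))
  convert! Complex.hasSum_ofReal.2 hsum1.hasSum using 2 with n
  simp [hg, Real.rpow_neg_one]

open HurwitzZeta Filter Topology in
lemma HurwitzZeta.hurwitzZetaOdd_one {a : ℝ} (ha0 : 0 < a) (ha1 : a < 1) :
    hurwitzZetaOdd (a : UnitAddCircle) 1 = Real.pi / 2 * Complex.cot (Real.pi * a) := by
  have hz : (a : ℂ) ∈ Complex.integerComplement := by
    rintro ⟨k, hk⟩
    have hk' : (k : ℝ) = a := by exact_mod_cast hk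
    rw [← hk'] at ha0 ha1
    have h0 : 0 < k := by exact_mod_cast ha0
    have h1 : k < 1 := by exact_mod_cast ha1
    omega
  have h1 := ((hasSum_hurwitzZetaOdd_one ha0 ha1).mul_left 2).tendsto_sum_nat
  have h2 := (summable_cotTerm hz).hasSum.tendsto_sum_nat
  have h2' : ∑' n, cotTerm (a : ℂ) n = Real.pi * Complex.cot (Real.pi * a) - 1 / a :=
    (cot_series_rep' hz).symm
  rw [h2'] at h2
  have h3 : Tendsto (fun N : ℕ => 1 / ((a : ℂ) + N)) atTop (𝓝 0) := by
    have : Tendsto (fun N : ℕ => 1 / (a + N)) atTop (𝓝 0) :=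
      tendsto_const_nhds.div_atTop (tendsto_atTop_add_const_left _ _ tendsto_natCast_atTop_atTop)
    exact_mod_cast (Complex.continuous_ofReal.tendsto 0).comp this
  have h4 : ∀ N : ℕ, ∑ n ∈ Finset.range N, (2 * ((1 / (n + a) - 1 / (n + 1 - a)) / 2 : ℂ)) =
      ∑ n ∈ Finset.range N, cotTerm (a : ℂ) n + 1 / a - 1 / (a + N) := by
    intro N
    induction N with
    | zero => simp
    | succ N ih =>
      have e : (1 : ℂ) / (N + 1 - a) = - (1 / (a - (N + 1))) := by
        rw [← neg_sub, div_neg]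
      rw [Finset.sum_range_succ, Finset.sum_range_succ, ih, cotTerm, e]
      push_cast
      ring
  simp_rw [h4] at h1
  have h5 := tendsto_nhds_unique h1 ((h2.add_const (1 / (a : ℂ))).sub h3)
  linear_combination h5 / 2

/-- The finite geometric-type sum `∑ k ψ(ak)` for the standard additive character. -/
lemma ZMod.sum_val_mul_stdAddChar_mul {N : ℕ} [NeZero N] [Fact (1 < N)] {a : ZMod N}
    (ha : stdAddChar a ≠ 1) :
    ∑ k : ZMod N, (k.val : ℂ) * stdAddChar (a * k) * (stdAddChar a - 1) = N := by
  have hsum : ∑ k : ZMod N, stdAddChar (a * k) = (0 : ℂ) := by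
    have := AddChar.sum_mulShift a (ZMod.isPrimitive_stdAddChar N)
    rw [if_neg (by rintro rfl; simp at ha)] at this
    simpa [mul_comm] using this
  have hval : ∀ k : ZMod N, ((k.val : ℂ)) = (k + 1).val - 1 + if k = -1 then (N : ℂ) else 0 := by
    intro k
    have hk := ZMod.val_add k 1
    rw [ZMod.val_one] at hk
    rcases (Nat.succ_le_of_lt (ZMod.val_lt k)).lt_or_eq with h | h
    · rw [Nat.mod_eq_of_lt h] at hk
      rw [if_neg, hk]
      · simp
      · rintro rfl
        simp at hk
    · rw [Nat.succ_eq_add_one] at h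
      rw [h, Nat.mod_self] at hk
      rw [if_pos (eq_neg_of_add_eq_zero_left ((ZMod.val_eq_zero _).1 hk)), hk]
      have := congrArg (Nat.cast : ℕ → ℂ) h
      push_cast at this ⊢
      linear_combination this
  have h1 : ∑ k : ZMod N, (k.val : ℂ) * stdAddChar (a * k) * stdAddChar a =
      ∑ k : ZMod N, (k.val : ℂ) * stdAddChar (a * k) + N := by
    have : ∀ k : ZMod N, (k.val : ℂ) * stdAddChar (a * k) * stdAddChar a =
        ((k + 1).val : ℂ) * stdAddChar (a * (k + 1)) - stdAddChar a * stdAddChar (a * k) +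
        if k = -1 then (N : ℂ) else 0 := by
      intro k
      rw [hval k, mul_add, mul_one, AddChar.map_add_eq_mul]
      split_ifs with h
      · have e : stdAddChar (a * k) * stdAddChar a = (1 : ℂ) := by
          rw [← AddChar.map_add_eq_mul, h]
          simp
        linear_combination (N : ℂ) * e
      · ring
    rw [Finset.sum_congr rfl fun k _ => this k, Finset.sum_add_distrib, Finset.sum_sub_distrib,
      ← Finset.mul_sum, hsum]
    have e := Equiv.sum_comp (Equiv.addRight (1 : ZMod N))
      (fun k => (k.val : ℂ) * stdAddChar (a * k))
    simp only [Equiv.coe_addRight] at e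
    rw [e]
    simp
  simp_rw [mul_sub, mul_one]
  rw [Finset.sum_sub_distrib, h1]
  ring

lemma quadraticChar_odd {p n : ℕ} [Fact p.Prime] (hpn : p = 2 * n + 1) (hodd : Odd n)
    (a : ZMod p) : quadraticChar (ZMod p) (-a) = -quadraticChar (ZMod p) a := by
  have hchar : ringChar (ZMod p) ≠ 2 := by
    have := hodd.pos
    rw [ZMod.ringChar_zmod_n]; omega
  have hneg : quadraticChar (ZMod p) (-1) = -1 := by
    rw [quadraticChar_neg_one hchar, ZMod.card, ZMod.χ₄_nat_three_mod_four]
    obtain ⟨k, rfl⟩ := hodd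
    omega
  rw [neg_eq_neg_one_mul, map_mul, hneg, neg_one_mul]

/-- The value at `1` of the `L`-function of the odd quadratic character modulo `p`. -/
lemma LFunction_quadraticChar_one {p n : ℕ} [Fact p.Prime] (hpn : p = 2 * n + 1) (hodd : Odd n) :
    DirichletCharacter.LFunction ((quadraticChar (ZMod p)).ringHomComp (Int.castRingHom ℂ)) 1 =
      -(Real.pi / (p * (√(p : ℝ) : ℝ))) *
        ((∑ k : ZMod p, quadraticChar (ZMod p) k * (k.val : ℤ) : ℤ) : ℂ) := by
  have hp0 : (p : ℂ) ≠ 0 := Nat.cast_ne_zero.2 (NeZero.ne p)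
  have hpR : (0 : ℝ) < p := Nat.cast_pos.2 (NeZero.pos p)
  have hsq : ((√(p : ℝ) : ℝ) : ℂ) * ((√(p : ℝ) : ℝ) : ℂ) = p := by
    rw [← Complex.ofReal_mul, Real.mul_self_sqrt hpR.le, Complex.ofReal_natCast]
  have hsq0 : ((√(p : ℝ) : ℝ) : ℂ) ≠ 0 := by
    intro h
    rw [h, mul_zero] at hsq
    exact hp0 hsq.symm
  set χ : DirichletCharacter ℂ p := (quadraticChar (ZMod p)).ringHomComp (Int.castRingHom ℂ)
    with hχ
  have hχa : ∀ a, χ a = ((quadraticChar (ZMod p) a : ℤ) : ℂ) := fun a => by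
    rw [hχ, MulChar.ringHomComp_apply]; rfl
  have hχodd : Function.Odd χ := fun a => by
    rw [hχa, hχa, quadraticChar_odd hpn hodd, Int.cast_neg]
  have hχ0 : χ 0 = 0 := by rw [hχa]; simp
  have hsum0 : ∑ a, χ a = 0 := by
    have h1 : ∑ a, χ (-a) = ∑ a, χ a := Equiv.sum_comp (Equiv.neg _) χ
    simp_rw [hχodd _, Finset.sum_neg_distrib] at h1
    linear_combination -h1 / 2
  have hτ := gaussSum_quadraticChar_eq_I_mul_sqrt hpn hodd
  rw [← hχ] at hτ
  have hgauss : ∀ k : ZMod p, ∑ a, χ a * ZMod.stdAddChar (a * k) =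
      χ k * (Complex.I * ((√(p : ℝ) : ℝ) : ℂ)) := by
    intro k
    rcases eq_or_ne k 0 with rfl | hk
    · simp [hχ0, hsum0]
    · have h1 := gaussSum_mulShift χ ZMod.stdAddChar (Units.mk0 k hk)
      have h2 : χ k * χ k = 1 := by
        rw [hχa, ← Int.cast_mul, ← sq, quadraticChar_sq_one hk, Int.cast_one]
      rw [hτ, Units.val_mk0] at h1
      rw [← h1, ← mul_assoc, h2, one_mul, gaussSum]
      exact Finset.sum_congr rfl fun a _ => by rw [AddChar.mulShift_apply, mul_comm a k]
  have hcot : ∀ a : ZMod p, χ a * HurwitzZeta.hurwitzZetaOdd (ZMod.toAddCircle a) 1 =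
      χ a * (Real.pi / 2 * (Complex.I *
        (1 + 2 / p * ∑ k : ZMod p, (k.val : ℂ) * ZMod.stdAddChar (a * k)))) := by
    intro a
    rcases eq_or_ne a 0 with rfl | ha
    · simp [hχ0]
    congr 1
    have hval : 0 < a.val := Nat.pos_of_ne_zero (by rwa [Ne, ZMod.val_eq_zero])
    have ha0 : (0 : ℝ) < a.val / p := by positivity
    have ha1 : (a.val : ℝ) / p < 1 := (div_lt_one hpR).2 (by exact_mod_cast ZMod.val_lt a)
    rw [ZMod.toAddCircle_apply, HurwitzZeta.hurwitzZetaOdd_one ha0 ha1, Complex.cot_eq_exp_ratio]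
    congr 1
    have hexp : Complex.exp (2 * Complex.I * (Real.pi * ((a.val / p : ℝ) : ℂ))) =
        ZMod.stdAddChar a := by
      rw [ZMod.stdAddChar_apply, ZMod.toCircle_apply]
      congr 1
      push_cast
      ring
    have hne : ZMod.stdAddChar a ≠ (1 : ℂ) := fun h =>
      ha (ZMod.injective_stdAddChar (by rw [h, AddChar.map_zero_eq_one]))
    have hs := ZMod.sum_val_mul_stdAddChar_mul hne
    rw [← Finset.sum_mul] at hs
    rw [hexp]
    have hne' : (1 : ℂ) - ZMod.stdAddChar a ≠ 0 := sub_ne_zero.2 hne.symm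
    set S := ∑ k : ZMod p, (k.val : ℂ) * ZMod.stdAddChar (a * k)
    set z : ℂ := ZMod.stdAddChar a
    rw [div_eq_iff (mul_ne_zero Complex.I_ne_zero hne')]
    field_simp
    linear_combination (-(p : ℂ) * (1 - z) - 2 * S * (1 - z)) * Complex.I_sq - 2 * hs
  change ZMod.LFunction χ 1 = _
  rw [ZMod.LFunction_def_odd hχodd, Finset.sum_congr rfl fun a _ => hcot a]
  have hfin : ∑ a, χ a * (Real.pi / 2 * (Complex.I *
        (1 + 2 / p * ∑ k : ZMod p, (k.val : ℂ) * ZMod.stdAddChar (a * k)))) =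
      Real.pi / 2 * Complex.I * ∑ a, χ a + Real.pi * Complex.I / p *
        ∑ k : ZMod p, (k.val : ℂ) * ∑ a, χ a * ZMod.stdAddChar (a * k) := by
    have h1 : ∑ k : ZMod p, (k.val : ℂ) * ∑ a, χ a * ZMod.stdAddChar (a * k) =
        ∑ a, χ a * ∑ k : ZMod p, (k.val : ℂ) * ZMod.stdAddChar (a * k) := by
      simp_rw [Finset.mul_sum]
      rw [Finset.sum_comm]
      exact Finset.sum_congr rfl fun a _ => Finset.sum_congr rfl fun k _ => by ring
    rw [h1, Finset.mul_sum, Finset.mul_sum, ← Finset.sum_add_distrib]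
    exact Finset.sum_congr rfl fun a _ => by ring
  rw [hfin, hsum0]
  simp_rw [hgauss]
  have e : ∑ k : ZMod p, (k.val : ℂ) * (χ k * (Complex.I * ((√(p : ℝ) : ℝ) : ℂ))) =
      (Complex.I * ((√(p : ℝ) : ℝ) : ℂ)) *
        ((∑ k : ZMod p, quadraticChar (ZMod p) k * (k.val : ℤ) : ℤ) : ℂ) := by
    push_cast
    rw [Finset.mul_sum]
    exact Finset.sum_congr rfl fun k _ => by rw [hχa]; ring
  rw [e, Complex.cpow_neg_one]
  generalize ((∑ k : ZMod p, quadraticChar (ZMod p) k * (k.val : ℤ) : ℤ) : ℂ) = M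
  field_simp
  rw [← hsq]
  linear_combination 2 * M * ((√(p : ℝ) : ℝ) : ℂ) * ((√(p : ℝ) : ℝ) : ℂ) * Complex.I_sq

lemma ZMod.sum_eq_zero_add_sum_range {M : Type*} [AddCommMonoid M] {p n : ℕ} [NeZero p]
    (hpn : p = 2 * n + 1) (f : ZMod p → M) :
    ∑ a, f a = f 0 + ∑ k ∈ Finset.range n,
      (f ((k + 1 : ℕ) : ZMod p) + f (-((k + 1 : ℕ) : ZMod p))) := by
  have h0 : ∑ a, f a = ∑ k ∈ Finset.range p, f (k : ZMod p) := by
    refine Finset.sum_bij' (fun a _ => a.val) (fun k _ => (k : ZMod p)) ?_ ?_ ?_ ?_ ?_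
    · exact fun a _ => Finset.mem_range.2 (ZMod.val_lt a)
    · exact fun _ _ => Finset.mem_univ _
    · exact fun a _ => ZMod.natCast_zmod_val a
    · exact fun k hk => ZMod.val_cast_of_lt (Finset.mem_range.1 hk)
    · exact fun a _ => by rw [ZMod.natCast_zmod_val]
  rw [h0, Finset.sum_add_distrib, show Finset.range p = Finset.range ((n + n) + 1) by
    rw [hpn, two_mul], Finset.sum_range_succ', Finset.sum_range_add, add_comm, Nat.cast_zero,
    ← Finset.sum_range_reflect (fun k => f (-((k + 1 : ℕ) : ZMod p)))]
  congr 2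
  refine Finset.sum_congr rfl fun k hk => congrArg f ?_
  have hk := Finset.mem_range.1 hk
  rw [eq_neg_iff_add_eq_zero, ← Nat.cast_add, show n + k + 1 + (n - 1 - k + 1) = p by omega,
    ZMod.natCast_self]

lemma sum_quadraticChar_mul_val {p n : ℕ} [Fact p.Prime] (hpn : p = 2 * n + 1) (hodd : Odd n) :
    (∑ k : ZMod p, quadraticChar (ZMod p) k * (k.val : ℤ)) * (2 - quadraticChar (ZMod p) 2) =
      -p * ∑ k ∈ Finset.range n, quadraticChar (ZMod p) ((k + 1 : ℕ) : ZMod p) := by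
  have h2 : (2 : ZMod p) ≠ 0 := by
    have hn := hodd.pos
    intro h
    have h' : ((2 : ℕ) : ZMod p) = 0 := by exact_mod_cast h
    exact absurd (Nat.le_of_dvd two_pos ((ZMod.natCast_eq_zero_iff 2 p).1 h')) (by omega)
  have hval : ∀ m : ℕ, 0 < m → m < p →
      quadraticChar (ZMod p) (m : ZMod p) * ((m : ZMod p).val : ℤ) +
        quadraticChar (ZMod p) (-(m : ZMod p)) * ((-(m : ZMod p)).val : ℤ) =
      quadraticChar (ZMod p) (m : ZMod p) * (2 * m - p) := by
    intro m hm0 hmp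
    have hne : (m : ZMod p) ≠ 0 := fun h =>
      absurd (Nat.le_of_dvd hm0 ((ZMod.natCast_eq_zero_iff m p).1 h)) (by omega)
    have : NeZero (m : ZMod p) := ⟨hne⟩
    rw [quadraticChar_odd hpn hodd, ZMod.val_neg_of_ne_zero, ZMod.val_cast_of_lt hmp,
      Nat.cast_sub hmp.le]
    ring
  set M := ∑ k : ZMod p, quadraticChar (ZMod p) k * (k.val : ℤ) with hM
  set A := ∑ k ∈ Finset.range n, quadraticChar (ZMod p) ((k + 1 : ℕ) : ZMod p) * ((k + 1 : ℕ) : ℤ)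
    with hA
  set S := ∑ k ∈ Finset.range n, quadraticChar (ZMod p) ((k + 1 : ℕ) : ZMod p) with hS
  have e1 : M = 2 * A - p * S := by
    rw [hM, ZMod.sum_eq_zero_add_sum_range hpn, hA, hS, Finset.mul_sum, Finset.mul_sum,
      ← Finset.sum_sub_distrib]
    simp only [MulChar.map_zero, zero_mul, zero_add]
    refine Finset.sum_congr rfl fun k hk => ?_
    have hk := Finset.mem_range.1 hk
    rw [hval (k + 1) (by omega) (by omega)]
    ring
  have e2 : M = quadraticChar (ZMod p) 2 * (4 * A - p * S) := by
    have : M = ∑ k : ZMod p, quadraticChar (ZMod p) (2 * k) * ((2 * k).val : ℤ) :=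
      (Equiv.sum_comp (Equiv.mulLeft₀ 2 h2)
        (fun k => quadraticChar (ZMod p) k * (k.val : ℤ))).symm
    rw [this, ZMod.sum_eq_zero_add_sum_range hpn, hA, hS, Finset.mul_sum, Finset.mul_sum,
      ← Finset.sum_sub_distrib, Finset.mul_sum]
    simp only [mul_zero, MulChar.map_zero, zero_mul, zero_add]
    refine Finset.sum_congr rfl fun k hk => ?_
    have hk := Finset.mem_range.1 hk
    have h3 := hval (2 * (k + 1)) (by omega) (by omega)
    have h4 : ((2 * (k + 1) : ℕ) : ZMod p) = 2 * ((k + 1 : ℕ) : ZMod p) := by push_cast; ring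
    rw [h4] at h3
    rw [mul_neg, h3, map_mul]
    push_cast
    ring
  have hsq : quadraticChar (ZMod p) 2 ^ 2 = 1 := quadraticChar_sq_one h2
  linear_combination 2 * e1 - quadraticChar (ZMod p) 2 * e2 - (4 * A - p * S) * hsq

section QuadraticBasis

variable {R S : Type*} [CommRing R] [CommRing S] [Algebra R S] (b : Module.Basis (Fin 2) R S)
  {u v : R}

lemma leftMulMatrix_quadraticBasis (h0 : b 0 = 1) (h1 : b 1 * b 1 = u • b 1 + v • b 0)
    (x y : R) :
    Algebra.leftMulMatrix b (x • b 0 + y • b 1) = !![x, y * v; y, x + y * u] := by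
  have e0 : (x • b 0 + y • b 1) * b 0 = x • b 0 + y • b 1 := by rw [h0, mul_one]
  have e1 : (x • b 0 + y • b 1) * b 1 = (y * v) • b 0 + (x + y * u) • b 1 := by
    rw [add_mul, smul_mul_assoc, smul_mul_assoc, h1, h0, one_mul]
    simp only [smul_add, smul_smul, add_smul]
    abel
  ext i j
  rw [Algebra.leftMulMatrix_eq_repr_mul]
  fin_cases i <;> fin_cases j <;> simp [e0, e1]

lemma trace_quadraticBasis (h0 : b 0 = 1) (h1 : b 1 * b 1 = u • b 1 + v • b 0) (x y : R) :
    Algebra.trace R S (x • b 0 + y • b 1) = 2 * x + y * u := by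
  rw [Algebra.trace_eq_matrix_trace b, leftMulMatrix_quadraticBasis b h0 h1]
  simp [Matrix.trace, Fin.sum_univ_two]
  ring

lemma norm_quadraticBasis (h0 : b 0 = 1) (h1 : b 1 * b 1 = u • b 1 + v • b 0) (x y : R) :
    Algebra.norm R (x • b 0 + y • b 1) = x ^ 2 + x * y * u - y ^ 2 * v := by
  rw [Algebra.norm_eq_matrix_det b, leftMulMatrix_quadraticBasis b h0 h1]
  simp [Matrix.det_fin_two]
  ring

lemma discr_quadraticBasis (h0 : b 0 = 1) (h1 : b 1 * b 1 = u • b 1 + v • b 0) :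
    Algebra.discr R b = u ^ 2 + 4 * v := by
  have t0 : Algebra.trace R S 1 = 2 := by
    have := trace_quadraticBasis b h0 h1 1 0
    simpa [h0] using this
  have t1 : Algebra.trace R S (b 1) = u := by
    have := trace_quadraticBasis b h0 h1 0 1
    simpa [h0] using this
  have t2 : Algebra.trace R S (b 1 * b 1) = 2 * v + u * u := by
    rw [h1, add_comm, trace_quadraticBasis b h0 h1]
  rw [Algebra.discr_def, Matrix.det_fin_two]
  simp only [Algebra.traceMatrix_apply, Algebra.traceForm_apply, t2, h0, one_mul, mul_one, t0, t1]
  ring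

end QuadraticBasis

section

variable {K : Type*} [Field K] [NumberField K] {α : K} {p : ℕ}

lemma exists_basis_of_sq_eq_neg (hp : 0 < p) (hα : α ^ 2 = -(p : K))
    (hK : ∀ x : K, ∃ a b : ℚ, x = (a : K) + (b : K) * α) :
    ∃ b : Module.Basis (Fin 2) ℚ K, b 0 = 1 ∧ b 1 = α := by
  have hli : LinearIndependent ℚ ![1, α] := by
    rw [LinearIndependent.pair_iff]
    intro s t h
    rw [Algebra.smul_def, Algebra.smul_def, mul_one] at h
    have h2 : ((s ^ 2 + p * t ^ 2 : ℚ) : K) = 0 := by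
      push_cast
      have h3 : (s : K) = -(t * α) := eq_neg_of_add_eq_zero_left h
      rw [h3]
      linear_combination (t : K) ^ 2 * hα
    rw [Rat.cast_eq_zero] at h2
    have hp' : (0 : ℚ) < p := by exact_mod_cast hp
    have hs : s = 0 := by nlinarith [sq_nonneg s, sq_nonneg t, mul_nonneg hp'.le (sq_nonneg t)]
    refine ⟨hs, ?_⟩
    rw [hs] at h2
    simpa [hp'.ne'] using h2
  have hspan : ⊤ ≤ Submodule.span ℚ (Set.range ![1, α]) := by
    rintro x -
    obtain ⟨a, b, rfl⟩ := hK x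
    have h1 : (1 : K) ∈ Submodule.span ℚ (Set.range ![1, α]) := Submodule.subset_span ⟨0, rfl⟩
    have h2 : α ∈ Submodule.span ℚ (Set.range ![1, α]) := Submodule.subset_span ⟨1, rfl⟩
    convert! add_mem (Submodule.smul_mem _ a h1) (Submodule.smul_mem _ b h2) using 1
    rw [Algebra.smul_def, Algebra.smul_def, mul_one]
    rfl
  exact ⟨Module.Basis.mk hli hspan, by simp, by simp⟩

lemma Rat.exists_int_eq_of_prime_mul_sq {p : ℕ} (hp : p.Prime) {t : ℚ} {m : ℤ}
    (h : p * t ^ 2 = m) : ∃ k : ℤ, t = k := by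
  have hp0 : (p : ℚ) ≠ 0 := Nat.cast_ne_zero.2 hp.ne_zero
  obtain ⟨w, hw⟩ : ∃ w : ℤ, (p * t) = (w : ℚ) := by
    have hintegral : IsIntegral ℤ (p * t : ℚ) := by
      refine IsIntegral.of_pow two_pos ?_
      rw [show (p * t : ℚ) ^ 2 = ((p * m : ℤ) : ℚ) by push_cast; rw [← h]; ring]
      exact isIntegral_algebraMap (A := ℚ) (R := ℤ)
    obtain ⟨w, hw⟩ := IsIntegrallyClosed.isIntegral_iff.1 hintegral
    exact ⟨w, hw.symm⟩
  have h2 : w ^ 2 = p * m := by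
    have : (w : ℚ) ^ 2 = p * m := by rw [← hw, ← h]; ring
    exact_mod_cast this
  obtain ⟨k, hk⟩ := (Nat.prime_iff_prime_int.1 hp).dvd_of_dvd_pow (Dvd.intro _ h2.symm)
  refine ⟨k, mul_left_cancel₀ hp0 ?_⟩
  rw [hw, hk]
  push_cast
  ring

open NumberField in
/-- The ring of integers of `ℚ(√-p)` for `p ≡ 3 (mod 4)`. -/
lemma exists_integralBasis_of_sq_eq_neg {c : ℕ} (hp : p.Prime) (hc : p + 1 = 4 * c)
    (hα : α ^ 2 = -(p : K)) (hK : ∀ x : K, ∃ a b : ℚ, x = (a : K) + (b : K) * α) :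
    ∃ b : Module.Basis (Fin 2) ℤ (𝓞 K), b 0 = 1 ∧ b 1 * b 1 = (1 : ℤ) • b 1 + (-c : ℤ) • b 0 := by
  obtain ⟨B, hB0, hB1⟩ := exists_basis_of_sq_eq_neg hp.pos hα hK
  have hB : B 1 * B 1 = (0 : ℚ) • B 1 + (-p : ℚ) • B 0 := by
    rw [hB0, hB1, ← sq, hα, Algebra.smul_def, Algebra.smul_def]
    simp
  have hcK : (p : K) + 1 = 4 * c := by exact_mod_cast congrArg (Nat.cast : ℕ → K) hc
  have hcQ : (p : ℚ) + 1 = 4 * c := by exact_mod_cast congrArg (Nat.cast : ℕ → ℚ) hc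
  have hθ : ((1 + α) / 2) * ((1 + α) / 2) = (1 + α) / 2 - c := by
    linear_combination hα / 4 - hcK / 4
  have hintegral : IsIntegral ℤ ((1 + α) / 2) := by
    refine ⟨Polynomial.X ^ 2 - Polynomial.X + Polynomial.C (c : ℤ), by monicity!, ?_⟩
    simp only [Polynomial.eval₂_add, Polynomial.eval₂_sub, Polynomial.eval₂_X_pow,
      Polynomial.eval₂_X, Polynomial.eval₂_C]
    push_cast
    linear_combination hθ
  let θ : 𝓞 K := ⟨(1 + α) / 2, hintegral⟩
  have hθc : algebraMap (𝓞 K) K θ = (1 + α) / 2 := rfl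
  have hcoe : ∀ x y : ℤ, algebraMap (𝓞 K) K (x • (1 : 𝓞 K) + y • θ) =
      ((x + y / 2 : ℚ) : K) + ((y / 2 : ℚ) : K) * α := by
    intro x y
    simp only [zsmul_eq_mul, map_add, map_mul, map_intCast, map_one, hθc]
    push_cast
    ring
  have huniq : ∀ a b a' b' : ℚ,
      (a : K) + (b : K) * α = (a' : K) + (b' : K) * α → a = a' ∧ b = b' := by
    intro a b a' b' h
    have h' : a • B 0 + b • B 1 = a' • B 0 + b' • B 1 := by
      rw [hB0, hB1]
      simpa [Algebra.smul_def] using h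
    have e0 := congrArg (fun z => B.repr z 0) h'
    have e1 := congrArg (fun z => B.repr z 1) h'
    simp at e0 e1
    exact ⟨e0, e1⟩
  have hli : LinearIndependent ℤ ![1, θ] := by
    rw [LinearIndependent.pair_iff]
    intro s t h
    have h1 := hcoe s t
    rw [h, map_zero] at h1
    obtain ⟨h2, h3⟩ := huniq 0 0 _ _ (by rw [← h1]; simp)
    have ht : (t : ℚ) = 0 := by linarith
    have hs : (s : ℚ) = 0 := by linarith
    exact ⟨by exact_mod_cast hs, by exact_mod_cast ht⟩
  have hspan : ⊤ ≤ Submodule.span ℤ (Set.range ![1, θ]) := by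
    rintro x -
    obtain ⟨a, b, hab⟩ := hK (algebraMap (𝓞 K) K x)
    have hab' : algebraMap (𝓞 K) K x = a • B 0 + b • B 1 := by
      rw [hab, hB0, hB1]
      simp [Algebra.smul_def]
    obtain ⟨u, hu⟩ := IsIntegrallyClosed.isIntegral_iff.1
      (Algebra.isIntegral_trace (L := ℚ) (RingOfIntegers.isIntegral_coe x))
    obtain ⟨N, hN⟩ := IsIntegrallyClosed.isIntegral_iff.1
      (Algebra.isIntegral_norm ℚ (RingOfIntegers.isIntegral_coe x))
    rw [hab', trace_quadraticBasis B hB0 hB] at hu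
    rw [hab', norm_quadraticBasis B hB0 hB] at hN
    simp only [eq_intCast, mul_zero, add_zero] at hu hN
    obtain ⟨v, hv⟩ := Rat.exists_int_eq_of_prime_mul_sq hp (t := 2 * b) (m := 4 * N - u ^ 2) (by
      push_cast
      rw [hu, hN]
      ring)
    have hpar : u ^ 2 + p * v ^ 2 = 4 * N := by
      have : (u : ℚ) ^ 2 + p * v ^ 2 = 4 * N := by
        rw [hu, hN, ← hv]; ring
      exact_mod_cast this
    obtain ⟨w, hw⟩ : (2 : ℤ) ∣ u - v := by
      rw [← even_iff_two_dvd, Int.even_sub]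
      have hodd : ¬ Even (p : ℤ) := by
        rw [Int.even_coe_nat, Nat.even_iff]
        omega
      have : Even (u ^ 2 + p * v ^ 2) := by rw [hpar]; exact ⟨2 * N, by ring⟩
      rw [Int.even_add, Int.even_mul, Int.even_pow' two_ne_zero, Int.even_pow' two_ne_zero] at this
      tauto
    have hx : x = w • (1 : 𝓞 K) + v • θ := by
      apply RingOfIntegers.coe_injective
      rw [hcoe, hab]
      have hwQ : (u : ℚ) - v = 2 * w := by exact_mod_cast hw
      have e1 : (w + v / 2 : ℚ) = a := by linarith
      have e2 : (v / 2 : ℚ) = b := by linarith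
      rw [e1, e2]
    rw [hx]
    have h1 : (1 : 𝓞 K) ∈ Submodule.span ℤ (Set.range ![1, θ]) := Submodule.subset_span ⟨0, rfl⟩
    have h2 : θ ∈ Submodule.span ℤ (Set.range ![1, θ]) := Submodule.subset_span ⟨1, rfl⟩
    exact add_mem (Submodule.smul_mem _ w h1) (Submodule.smul_mem _ v h2)
  refine ⟨Module.Basis.mk hli hspan, by simp, ?_⟩
  apply RingOfIntegers.coe_injective
  simp [hθc]
  linear_combination hθ

end

section

open NumberField

variable {K : Type*} [Field K] [NumberField K] {α : K} {p c : ℕ}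

lemma isTotallyComplex_of_sq_eq_neg (hp : 0 < p) (hα : α ^ 2 = -(p : K)) :
    IsTotallyComplex K where
  isComplex w := by
    rw [← InfinitePlace.not_isReal_iff_isComplex]
    intro hw
    have h := congrArg (InfinitePlace.embedding_of_isReal hw) hα
    rw [map_pow, map_neg, map_natCast] at h
    have hp' : (0 : ℝ) < p := by exact_mod_cast hp
    nlinarith [sq_nonneg (InfinitePlace.embedding_of_isReal hw α)]

lemma NumberField.Units.regulator_eq_one_of_rank_eq_zero (h : Units.rank K = 0) :
    Units.regulator K = 1 := by
  classical
  have : IsEmpty (Fin (Units.rank K)) := by rw [h]; infer_instance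
  have : IsEmpty {w : InfinitePlace K // w ≠ Units.dirichletUnitTheorem.w₀} :=
    (Units.equivFinRank K).symm.isEmpty
  rw [Units.regulator_eq_det' K, Matrix.det_isEmpty, abs_one]

variable (b : Module.Basis (Fin 2) ℤ (𝓞 K))

lemma torsionOrder_eq_two_of_quadraticBasis (hc : 1 < c) (h0 : b 0 = 1)
    (h1 : b 1 * b 1 = (1 : ℤ) • b 1 + (-c : ℤ) • b 0) : Units.torsionOrder K = 2 := by
  have hu : ∀ u : (𝓞 K)ˣ, u = 1 ∨ u = -1 := by
    intro u
    obtain ⟨x, y, hxy⟩ : ∃ x y : ℤ, (u : 𝓞 K) = x • b 0 + y • b 1 :=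
      ⟨b.repr u 0, b.repr u 1, by rw [← Fin.sum_univ_two (f := fun i => b.repr u i • b i), b.sum_repr]⟩
    have hN : IsUnit (Algebra.norm ℤ (u : 𝓞 K)) := u.isUnit.map _
    rw [hxy, norm_quadraticBasis b h0 h1] at hN
    have hc' : (1 : ℤ) < c := by exact_mod_cast hc
    have hN' : 4 * (x ^ 2 + x * y * 1 - y ^ 2 * -(c : ℤ)) = (2 * x + y) ^ 2 + (4 * c - 1) * y ^ 2 := by
      ring
    have hy : y = 0 := by
      by_contra hy
      have : 1 ≤ y ^ 2 := by have := sq_pos_of_ne_zero hy; omega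
      rcases Int.isUnit_iff.1 hN with h | h <;> nlinarith [sq_nonneg (2 * x + y)]
    subst hy
    simp only [zero_smul, add_zero, h0] at hxy
    have hx : x = 1 ∨ x = -1 := by
      rcases Int.isUnit_iff.1 hN with h | h
      · exact sq_eq_sq_iff_eq_or_eq_neg.1 (by linarith)
      · nlinarith [sq_nonneg x]
    rcases hx with rfl | rfl
    · exact Or.inl (Units.ext (by simpa using hxy))
    · exact Or.inr (Units.ext (by simpa using hxy))
  refine le_antisymm ?_ ?_
  · rw [Units.torsionOrder]
    have : (Units.torsion K : Set (𝓞 K)ˣ) ⊆ {1, -1} := fun u _ => by simpa using hu u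
    calc Nat.card (Units.torsion K) = (Units.torsion K : Set (𝓞 K)ˣ).ncard := rfl
      _ ≤ ({1, -1} : Set (𝓞 K)ˣ).ncard := Set.ncard_le_ncard this
      _ ≤ 2 := (Set.ncard_insert_le _ _).trans (by rw [Set.ncard_singleton])
  · exact Nat.le_of_dvd (Units.torsionOrder_pos K) (Units.even_torsionOrder K).two_dvd

lemma dedekindZeta_residue_of_sq_eq_neg (hc : 1 < c) (hpc : p + 1 = 4 * c)
    (hα : α ^ 2 = -(p : K)) (h0 : b 0 = 1) (h1 : b 1 * b 1 = (1 : ℤ) • b 1 + (-c : ℤ) • b 0) :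
    dedekindZeta_residue K = Real.pi * classNumber K / √(p : ℝ) := by
  have := isTotallyComplex_of_sq_eq_neg (by omega) hα
  have hfin : Module.finrank ℚ K = 2 := by
    rw [← RingOfIntegers.rank, Module.finrank_eq_card_basis b, Fintype.card_fin]
  have hr : InfinitePlace.nrRealPlaces K = 0 := IsTotallyComplex.nrRealPlaces_eq_zero K
  have hcplx : InfinitePlace.nrComplexPlaces K = 1 := by
    have := InfinitePlace.card_add_two_mul_card_eq_rank K
    omega
  have hrank : Units.rank K = 0 := by
    rw [Units.rank, InfinitePlace.card_eq_nrRealPlaces_add_nrComplexPlaces, hr, hcplx]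
  have hdiscr : discr K = -p := by
    rw [← discr_eq_discr K b, discr_quadraticBasis b h0 h1]
    have : (p : ℤ) + 1 = 4 * c := by exact_mod_cast hpc
    linarith
  rw [dedekindZeta_residue_def, hr, hcplx, Units.regulator_eq_one_of_rank_eq_zero hrank,
    torsionOrder_eq_two_of_quadraticBasis b hc h0 h1, hdiscr]
  simp only [pow_zero, pow_one, one_mul, mul_one, Int.cast_neg, Int.cast_natCast, abs_neg,
    Nat.abs_cast, Nat.cast_ofNat]
  rw [mul_assoc, mul_div_mul_left _ _ two_ne_zero]

end

section IdealCount

open Ideal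

variable {R : Type*} [CommRing R] [IsDedekindDomain R] [Module.Free ℤ R]

lemma Ideal.isCoprime_of_coprime_absNorm {I J : Ideal R}
    (h : (absNorm I).Coprime (absNorm J)) : IsCoprime I J := by
  rw [Ideal.isCoprime_iff_exists]
  obtain ⟨u, v, huv⟩ := Nat.isCoprime_iff_coprime.2 h
  refine ⟨(u : R) * (absNorm I : R), I.mul_mem_left _ (absNorm_mem I),
    (v : R) * (absNorm J : R), J.mul_mem_left _ (absNorm_mem J), ?_⟩
  exact_mod_cast congrArg (Int.cast : ℤ → R) huv

lemma Ideal.card_absNorm_eq_one : Nat.card {I : Ideal R // absNorm I = 1} = 1 := by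
  simp [absNorm_eq_one_iff]

variable [Module.Finite ℤ R]

lemma Ideal.exists_mul_eq_of_absNorm_eq_mul {m n : ℕ} (h : m.Coprime n) {L : Ideal R}
    (hL : absNorm L = m * n) : ∃ I J : Ideal R, absNorm I = m ∧ absNorm J = n ∧ I * J = L := by
  have hdvd : L ∣ span {(m : R)} * span {(n : R)} := by
    rw [Ideal.span_singleton_mul_span_singleton, Ideal.dvd_span_singleton, ← Nat.cast_mul, ← hL]
    exact absNorm_mem L
  obtain ⟨I, J, hI, hJ, rfl⟩ := exists_dvd_and_dvd_of_dvd_mul hdvd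
  have hI' := map_dvd absNorm hI
  have hJ' := map_dvd absNorm hJ
  rw [absNorm_span_natCast] at hI' hJ'
  rw [map_mul] at hL
  have hIn : (absNorm I).Coprime n := Nat.Coprime.of_dvd_left hI' (h.pow_left _)
  have hJm : (absNorm J).Coprime m := Nat.Coprime.of_dvd_left hJ' (h.symm.pow_left _)
  refine ⟨I, J, Nat.dvd_antisymm ?_ ?_, Nat.dvd_antisymm ?_ ?_, rfl⟩
  · exact hIn.dvd_of_dvd_mul_right (hL ▸ dvd_mul_right _ _)
  · exact hJm.symm.dvd_of_dvd_mul_right (hL ▸ dvd_mul_right _ _)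
  · exact hJm.dvd_of_dvd_mul_left (hL ▸ dvd_mul_left _ _)
  · exact hIn.symm.dvd_of_dvd_mul_left (hL ▸ dvd_mul_left _ _)

lemma Ideal.card_absNorm_eq_mul {m n : ℕ} (h : m.Coprime n) :
    Nat.card {I : Ideal R // absNorm I = m * n} =
      Nat.card {I : Ideal R // absNorm I = m} * Nat.card {I : Ideal R // absNorm I = n} := by
  rw [← Nat.card_prod]
  symm
  refine Nat.card_eq_of_bijective
    (fun x : {I : Ideal R // absNorm I = m} × {I : Ideal R // absNorm I = n} ↦
      (⟨x.1.1 * x.2.1, by rw [map_mul, x.1.2, x.2.2]⟩ : {I : Ideal R // absNorm I = m * n}))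
    ⟨?_, ?_⟩
  · have key : ∀ {I J I' J' : Ideal R}, (absNorm I).Coprime (absNorm J') → I * J = I' * J' →
        I ∣ I' := fun hc he ↦
      (isCoprime_of_coprime_absNorm hc).dvd_of_dvd_mul_right (he ▸ dvd_mul_right _ _)
    rintro ⟨⟨I, hI⟩, ⟨J, hJ⟩⟩ ⟨⟨I', hI'⟩, ⟨J', hJ'⟩⟩ he
    simp only [Subtype.mk.injEq] at he
    simp only [Prod.mk.injEq, Subtype.mk.injEq]
    have he' : J * I = J' * I' := by rw [mul_comm, he, mul_comm]
    refine ⟨dvd_antisymm (key ?_ he) (key ?_ he.symm),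
      dvd_antisymm (key ?_ he') (key ?_ he'.symm)⟩
    all_goals rw [‹absNorm _ = _›, ‹absNorm _ = _›]
    all_goals first | exact h | exact h.symm
  · rintro ⟨L, hL⟩
    obtain ⟨I, J, hI, hJ, rfl⟩ := exists_mul_eq_of_absNorm_eq_mul h hL
    exact ⟨(⟨I, hI⟩, ⟨J, hJ⟩), rfl⟩

end IdealCount

section PrimePowerNorm

open Ideal

variable {R : Type*} [CommRing R] [IsDedekindDomain R]

lemma Ideal.injOn_pow_mul_pow_antidiagonal {P Q : Ideal R} (hP : Prime P) (hQ : Prime Q)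
    (hPQ : P ≠ Q) (k : ℕ) :
    Set.InjOn (fun x : ℕ × ℕ ↦ P ^ x.1 * Q ^ x.2)
      (Finset.HasAntidiagonal.antidiagonal k : Set (ℕ × ℕ)) := by
  have key : ∀ i j i' j' : ℕ, P ^ i * Q ^ j = P ^ i' * Q ^ j' → ¬ i < i' := by
    intro i j i' j' h hlt
    obtain ⟨d, rfl⟩ := Nat.exists_eq_add_of_lt hlt
    rw [show i + d + 1 = i + (d + 1) by ring, pow_add, mul_assoc] at h
    have h' := mul_left_cancel₀ (pow_ne_zero i hP.ne_zero) h
    have hdvd : P ∣ Q ^ j := by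
      rw [h']
      exact (dvd_pow_self P d.succ_ne_zero).mul_right _
    exact hPQ (associated_iff_eq.1 (hP.associated_of_dvd hQ (hP.dvd_of_dvd_pow hdvd)))
  rintro ⟨i, j⟩ hx ⟨i', j'⟩ hy h
  simp only [Finset.mem_coe, Finset.HasAntidiagonal.mem_antidiagonal] at hx hy
  have h1 := key _ _ _ _ h
  have h2 := key _ _ _ _ h.symm
  obtain rfl : i = i' := by lia
  obtain rfl : j = j' := by lia
  rfl

variable [Module.Free ℤ R]

lemma Ideal.dvd_span_natCast_pow_of_absNorm {q k : ℕ} {I : Ideal R} (hI : absNorm I = q ^ k) :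
    I ∣ span {(q : R)} ^ k := by
  rw [Ideal.span_singleton_pow, Ideal.dvd_span_singleton, ← Nat.cast_pow, ← hI]
  exact absNorm_mem I

variable [Module.Finite ℤ R]

lemma Ideal.card_absNorm_eq_pow_of_prime (hR : Module.finrank ℤ R = 2) {q : ℕ} (hq : q.Prime)
    (h : Prime (span {(q : R)})) (k : ℕ) :
    Nat.card {I : Ideal R // absNorm I = q ^ k} = if Even k then 1 else 0 := by
  have key : ∀ I : Ideal R, absNorm I = q ^ k → ∃ i, I = span {(q : R)} ^ i ∧ 2 * i = k := by
    intro I hI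
    obtain ⟨i, -, hi⟩ := (dvd_prime_pow h k).1 (dvd_span_natCast_pow_of_absNorm hI)
    obtain rfl := associated_iff_eq.1 hi
    rw [map_pow, absNorm_span_natCast, hR, ← pow_mul] at hI
    exact ⟨i, rfl, Nat.pow_right_injective hq.two_le hI⟩
  split_ifs with hk
  · obtain ⟨m, rfl⟩ := hk
    rw [Nat.card_eq_one_iff_exists]
    refine ⟨⟨span {(q : R)} ^ m, by rw [map_pow, absNorm_span_natCast, hR, ← pow_mul, two_mul]⟩,
      fun ⟨I, hI⟩ ↦ ?_⟩
    obtain ⟨i, rfl, hi⟩ := key I hI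
    obtain rfl : i = m := by lia
    rfl
  · rw [Nat.card_eq_zero]
    left
    refine ⟨fun ⟨I, hI⟩ ↦ hk ?_⟩
    obtain ⟨i, -, hi⟩ := key I hI
    exact ⟨i, by lia⟩

lemma Ideal.setOf_absNorm_eq_pow_of_mul_eq {q : ℕ} (hq : q.Prime) {P Q : Ideal R}
    (hP : absNorm P = q) (hQ : absNorm Q = q) (hPQ : P * Q = span {(q : R)}) (k : ℕ) :
    {I : Ideal R | absNorm I = q ^ k} =
      (fun x : ℕ × ℕ ↦ P ^ x.1 * Q ^ x.2) ''
      (Finset.HasAntidiagonal.antidiagonal k : Set (ℕ × ℕ)) := by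
  have hP0 : P ≠ ⊥ := by rw [Ne, ← absNorm_eq_zero_iff, hP]; exact hq.ne_zero
  have hQ0 : Q ≠ ⊥ := by rw [Ne, ← absNorm_eq_zero_iff, hQ]; exact hq.ne_zero
  have hPp : Prime P := prime_of_isPrime hP0 (isPrime_of_irreducible_absNorm (hP ▸ hq))
  have hQp : Prime Q := prime_of_isPrime hQ0 (isPrime_of_irreducible_absNorm (hQ ▸ hq))
  ext I
  simp only [Set.mem_ofPred_eq, Set.mem_image, Finset.mem_coe,
    Finset.HasAntidiagonal.mem_antidiagonal, Prod.exists]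
  constructor
  · intro hI
    have hdvd := dvd_span_natCast_pow_of_absNorm hI
    rw [← hPQ, mul_pow] at hdvd
    obtain ⟨A, B, hA, hB, rfl⟩ := exists_dvd_and_dvd_of_dvd_mul hdvd
    obtain ⟨i, -, hi⟩ := (dvd_prime_pow hPp k).1 hA
    obtain ⟨j, -, hj⟩ := (dvd_prime_pow hQp k).1 hB
    obtain rfl := associated_iff_eq.1 hi
    obtain rfl := associated_iff_eq.1 hj
    rw [map_mul, map_pow, map_pow, hP, hQ, ← pow_add] at hI
    exact ⟨i, j, Nat.pow_right_injective hq.two_le hI, rfl⟩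
  · rintro ⟨i, j, rfl, rfl⟩
    rw [map_mul, map_pow, map_pow, hP, hQ, ← pow_add]

/-- In a quadratic order, the number of ideals of norm `q ^ k`, as a function of `k`, is the one
dictated by a local Euler factor `1 / ((1 - X) (1 - ε X))`. -/
lemma Ideal.card_absNorm_eq_prime_pow (hR : Module.finrank ℤ R = 2) {q : ℕ} (hq : q.Prime)
    (k : ℕ) : (Nat.card {I : Ideal R // absNorm I = q ^ k} : ℤ) =
      ∑ i ∈ Finset.range (k + 1), ((Nat.card {I : Ideal R // absNorm I = q} : ℤ) - 1) ^ i := by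
  by_cases h : Prime (span {(q : R)})
  · have h1 := card_absNorm_eq_pow_of_prime hR hq h 1
    rw [pow_one] at h1
    rw [card_absNorm_eq_pow_of_prime hR hq h, h1]
    norm_num
    by_cases hk : Even k <;> simp [hk, Nat.even_add_one]
  · obtain ⟨P, Q, hP, hQ, hPQ⟩ : ∃ P Q : Ideal R, absNorm P = q ∧ absNorm Q = q ∧
        P * Q = span {(q : R)} := by
      have hN : absNorm (span {(q : R)}) = q ^ 2 := by rw [absNorm_span_natCast, hR]
      have hu : ¬ IsUnit (span {(q : R)}) := by
        rw [isUnit_iff, ← absNorm_eq_one_iff, hN]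
        simpa using hq.ne_one
      rw [← UniqueFactorizationMonoid.irreducible_iff_prime, irreducible_iff] at h
      push Not at h
      obtain ⟨P, Q, hPQ, hPu, hQu⟩ := h hu
      rw [isUnit_iff, ← absNorm_eq_one_iff] at hPu hQu
      rw [hPQ, map_mul, hq.mul_eq_prime_sq_iff hPu hQu] at hN
      exact ⟨P, Q, hN.1, hN.2, hPQ.symm⟩
    have hP0 : P ≠ ⊥ := by rw [Ne, ← absNorm_eq_zero_iff, hP]; exact hq.ne_zero
    have hQ0 : Q ≠ ⊥ := by rw [Ne, ← absNorm_eq_zero_iff, hQ]; exact hq.ne_zero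
    have hPp : Prime P := prime_of_isPrime hP0 (isPrime_of_irreducible_absNorm (hP ▸ hq))
    have hQp : Prime Q := prime_of_isPrime hQ0 (isPrime_of_irreducible_absNorm (hQ ▸ hq))
    by_cases hne : P = Q
    · subst hne
      have key : ∀ k, Nat.card {I : Ideal R // absNorm I = q ^ k} = 1 := by
        intro k
        change Nat.card ({I : Ideal R | absNorm I = q ^ k} : Set (Ideal R)) = 1
        rw [setOf_absNorm_eq_pow_of_mul_eq hq hP hQ hPQ, Nat.card_coe_set_eq, Set.ncard_eq_one]
        refine ⟨P ^ k, ?_⟩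
        ext I
        simp only [Set.mem_image, Finset.mem_coe, Finset.HasAntidiagonal.mem_antidiagonal, Prod.exists,
          Set.mem_singleton_iff, ← pow_add]
        constructor
        · rintro ⟨i, j, rfl, rfl⟩
          rfl
        · rintro rfl
          exact ⟨k, 0, rfl, rfl⟩
      have h1 := key 1
      rw [pow_one] at h1
      rw [key, h1, Finset.sum_range_succ']
      simp
    · have key : ∀ k, Nat.card {I : Ideal R // absNorm I = q ^ k} = k + 1 := by
        intro k
        change Nat.card ({I : Ideal R | absNorm I = q ^ k} : Set (Ideal R)) = k + 1
        rw [setOf_absNorm_eq_pow_of_mul_eq hq hP hQ hPQ, Nat.card_coe_set_eq,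
          (injOn_pow_mul_pow_antidiagonal hPp hQp hne k).ncard_image,
          Set.ncard_coe_finset, Finset.Nat.card_antidiagonal]
      have h1 := key 1
      rw [pow_one] at h1
      rw [key, h1]
      simp

end PrimePowerNorm

section QuadraticRoots

variable {R A : Type*} [CommRing R] [CommRing A] (b : Module.Basis (Fin 2) ℤ R) {u v : ℤ}

lemma exists_ringHom_of_quadraticBasis (h0 : b 0 = 1) (h1 : b 1 * b 1 = u • b 1 + v • b 0) {x : A}
    (hx : x * x = u * x + v) : ∃ φ : R →+* A, φ (b 1) = x := by
  have hrepr : ∀ z, z = b.repr z 0 • b 0 + b.repr z 1 • b 1 := fun z ↦ by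
    conv_lhs => rw [← b.sum_repr z, Fin.sum_univ_two]
  have hcoord : ∀ s t : ℤ, b.repr (s • b 0 + t • b 1) 0 = s ∧ b.repr (s • b 0 + t • b 1) 1 = t := by
    intro s t
    simp [-zsmul_eq_mul]
  have hmul : ∀ s t s' t' : ℤ, (s • b 0 + t • b 1) * (s' • b 0 + t' • b 1) =
      (s * s' + t * t' * v) • b 0 + (s * t' + t * s' + t * t' * u) • b 1 := by
    intro s t s' t'
    simp only [zsmul_eq_mul, h0, mul_one] at h1 ⊢
    push_cast
    linear_combination (t * t' : R) * h1
  refine ⟨{ toFun := fun z ↦ b.repr z 0 + b.repr z 1 * x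
            map_one' := ?_
            map_mul' := ?_
            map_zero' := by simp
            map_add' := fun z w ↦ by simp; ring }, ?_⟩
  · rw [← h0]
    simp
  · intro z w
    have hzw := hmul (b.repr z 0) (b.repr z 1) (b.repr w 0) (b.repr w 1)
    rw [← hrepr, ← hrepr] at hzw
    rw [hzw, (hcoord _ _).1, (hcoord _ _).2]
    push_cast
    linear_combination -(b.repr z 1 * b.repr w 1 : A) * hx
  · change ((b.repr (b 1) 0 : ℤ) : A) + (b.repr (b 1) 1 : ℤ) * x = x
    simp

lemma card_ringHom_of_quadraticBasis (h0 : b 0 = 1) (h1 : b 1 * b 1 = u • b 1 + v • b 0) :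
    Nat.card (R →+* A) = Nat.card {x : A // x * x = u * x + v} := by
  refine Nat.card_eq_of_bijective
    (fun φ : R →+* A ↦ (⟨φ (b 1), by
      rw [← map_mul, h1, h0]
      simp⟩ : {x : A // x * x = u * x + v})) ⟨?_, ?_⟩
  · intro φ ψ h
    simp only [Subtype.mk.injEq] at h
    ext z
    rw [← b.sum_repr z, Fin.sum_univ_two, h0]
    simp [h]
  · rintro ⟨x, hx⟩
    obtain ⟨φ, hφ⟩ := exists_ringHom_of_quadraticBasis b h0 h1 hx
    exact ⟨φ, Subtype.ext hφ⟩

end QuadraticRoots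

lemma Ideal.card_absNorm_eq_prime {R : Type*} [CommRing R] [IsDedekindDomain R] [Module.Free ℤ R]
    {q : ℕ} (hq : q.Prime) :
    Nat.card {I : Ideal R // absNorm I = q} = Nat.card (R →+* ZMod q) := by
  have hsurj : ∀ φ : R →+* ZMod q, Function.Surjective φ := fun φ ↦ ZMod.ringHom_surjective φ
  symm
  refine Nat.card_eq_of_bijective
    (fun φ : R →+* ZMod q ↦ (⟨RingHom.ker φ, by
      rw [absNorm_apply, Submodule.cardQuot_apply,
        Nat.card_congr (RingHom.quotientKerEquivOfSurjective (hsurj φ)).toEquiv, Nat.card_zmod]⟩ :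
      {I : Ideal R // absNorm I = q})) ⟨?_, ?_⟩
  · intro φ ψ h
    simp only [Subtype.mk.injEq] at h
    ext z
    obtain ⟨m, hm⟩ := ZMod.intCast_surjective (φ z)
    have hz : z - m ∈ RingHom.ker φ := by simp [RingHom.mem_ker, hm]
    rw [h, RingHom.mem_ker, map_sub, map_intCast, sub_eq_zero] at hz
    rw [hz, hm]
  · rintro ⟨I, hI⟩
    have hcard : Nat.card (R ⧸ I) = q := by
      rwa [absNorm_apply, Submodule.cardQuot_apply] at hI
    have hfin : Finite (R ⧸ I) := Nat.finite_of_card_ne_zero (hcard ▸ hq.ne_zero)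
    have := Fintype.ofFinite (R ⧸ I)
    let e := ZMod.ringEquivOfPrime (R ⧸ I) hq (by rwa [← Nat.card_eq_fintype_card])
    refine ⟨e.symm.toRingHom.comp (Ideal.Quotient.mk I), Subtype.ext ?_⟩
    ext z
    simp [RingHom.mem_ker, Ideal.Quotient.eq_zero_iff_mem]

lemma card_sq_eq_neg_prime {p c q : ℕ} [Fact p.Prime] [Fact q.Prime] (hpc : p + 1 = 4 * c)
    (hq : q ≠ 2) : (Nat.card {y : ZMod q // y ^ 2 = -(p : ZMod q)} : ℤ) =
      quadraticChar (ZMod p) (q : ZMod p) + 1 := by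
  have hp2 : ringChar (ZMod p) ≠ 2 := by rw [ZMod.ringChar_zmod_n]; lia
  have hq2 : ringChar (ZMod q) ≠ 2 := by rwa [ZMod.ringChar_zmod_n]
  have h := quadraticChar_card_sqrts hq2 (-(p : ZMod q))
  rw [Set.toFinset_card, ← Nat.card_eq_fintype_card] at h
  refine h.trans (congrArg (· + 1) ?_)
  by_cases hpq : p = q
  · subst hpq
    simp
  · rw [quadraticChar_odd_prime hp2 hq (by rwa [ZMod.ringChar_zmod_n]), ZMod.card,
      ZMod.χ₄_nat_three_mod_four (by lia)]
    simp

lemma card_roots_eq_quadraticChar_add_one {p c q : ℕ} [Fact p.Prime] [Fact q.Prime]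
    (hpc : p + 1 = 4 * c) :
    (Nat.card {x : ZMod q // x * x = ((1 : ℤ) : ZMod q) * x + ((-c : ℤ) : ZMod q)} : ℤ) =
      quadraticChar (ZMod p) (q : ZMod p) + 1 := by
  by_cases hq : q = 2
  · subst hq
    have hp2 : ringChar (ZMod p) ≠ 2 := by rw [ZMod.ringChar_zmod_n]; lia
    have h2 : quadraticChar (ZMod p) ((2 : ℕ) : ZMod p) = if p % 8 = 7 then 1 else -1 := by
      rw [Nat.cast_two, quadraticChar_two hp2, ZMod.card, ZMod.χ₈_nat_eq_if_mod_eight,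
        if_neg (by lia)]
      exact if_congr (by lia) rfl rfl
    rw [h2]
    simp only [Int.cast_one, Int.cast_neg, Int.cast_natCast]
    rcases Nat.even_or_odd c with hc | hc
    · have hc' : (c : ZMod 2) = 0 := (ZMod.natCast_eq_zero_iff_even).2 hc
      rw [if_pos (by obtain ⟨d, rfl⟩ := hc; lia), Nat.card_congr (Equiv.subtypeUnivEquiv fun x ↦ ?_),
        Nat.card_zmod]
      · rfl
      · rw [hc', ← sq, ZMod.pow_card]
        ring
    · have hc' : (c : ZMod 2) = 1 := (ZMod.natCast_eq_one_iff_odd).2 hc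
      have hempty : IsEmpty {x : ZMod 2 // x * x = 1 * x + -(c : ZMod 2)} := by
        refine ⟨fun ⟨x, hx⟩ ↦ ?_⟩
        rw [hc', ← sq, ZMod.pow_card, one_mul, left_eq_add, neg_eq_zero] at hx
        exact one_ne_zero hx
      rw [if_neg (by obtain ⟨d, rfl⟩ := hc; lia), Nat.card_of_isEmpty]
      rfl
  · rw [← card_sq_eq_neg_prime hpc hq]
    have hp : (p : ZMod q) + 1 = 4 * c := by exact_mod_cast congrArg (Nat.cast : ℕ → ZMod q) hpc
    have h2 : (2 : ZMod q) ≠ 0 := Ring.two_ne_zero (by rwa [ZMod.ringChar_zmod_n])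
    have h4 : (4 : ZMod q) ≠ 0 := by
      rw [show (4 : ZMod q) = 2 * 2 by norm_num]
      exact mul_ne_zero h2 h2
    congr 1
    refine Nat.card_congr (Equiv.subtypeEquiv
      ⟨fun x ↦ 2 * x - 1, fun y ↦ (y + 1) / 2, fun x ↦ ?_, fun y ↦ ?_⟩ fun x ↦ ?_)
    · field_simp
      ring
    · field_simp
      ring
    · push_cast
      change _ ↔ (2 * x - 1) ^ 2 = -(p : ZMod q)
      constructor
      · intro h
        linear_combination 4 * h + hp
      · intro h
        refine mul_left_cancel₀ h4 ?_
        linear_combination h - hp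

section Factorization

open Ideal ArithmeticFunction
open scoped ArithmeticFunction.zeta

variable {R : Type*} [CommRing R] [IsDedekindDomain R] [Module.Free ℤ R] [Module.Finite ℤ R]
  {p c : ℕ} [Fact p.Prime] (b : Module.Basis (Fin 2) ℤ R)

/-- The number of ideals of norm `n` in the imaginary quadratic order of discriminant `-p`. -/
lemma card_absNorm_eq_sum_quadraticChar (hpc : p + 1 = 4 * c) (h0 : b 0 = 1)
    (h1 : b 1 * b 1 = (1 : ℤ) • b 1 + (-c : ℤ) • b 0) {n : ℕ} (hn : n ≠ 0) :
    (Nat.card {I : Ideal R // absNorm I = n} : ℤ) =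
      ∑ d ∈ n.divisors, quadraticChar (ZMod p) (d : ZMod p) := by
  let r : ArithmeticFunction ℤ :=
    toArithmeticFunction fun n ↦ (Nat.card {I : Ideal R // absNorm I = n} : ℤ)
  let χ : ArithmeticFunction ℤ :=
    toArithmeticFunction fun n ↦ quadraticChar (ZMod p) (n : ZMod p)
  have hr : ∀ {n : ℕ}, n ≠ 0 → r n = Nat.card {I : Ideal R // absNorm I = n} := fun h ↦ if_neg h
  have hχ : ∀ {n : ℕ}, n ≠ 0 → χ n = quadraticChar (ZMod p) (n : ZMod p) := fun h ↦ if_neg h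
  have hrm : r.IsMultiplicative := by
    rw [IsMultiplicative.iff_ne_zero]
    refine ⟨by rw [hr one_ne_zero, card_absNorm_eq_one, Nat.cast_one], fun hm hn h ↦ ?_⟩
    rw [hr hm, hr hn, hr (mul_ne_zero hm hn), card_absNorm_eq_mul h, Nat.cast_mul]
  have hχm : χ.IsMultiplicative := by
    rw [IsMultiplicative.iff_ne_zero]
    refine ⟨by rw [hχ one_ne_zero, Nat.cast_one, map_one], fun hm hn _ ↦ ?_⟩
    rw [hχ hm, hχ hn, hχ (mul_ne_zero hm hn), Nat.cast_mul, map_mul]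
  have hR : Module.finrank ℤ R = 2 := by rw [Module.finrank_eq_card_basis b, Fintype.card_fin]
  have key : r = ((ζ : ArithmeticFunction ℕ) : ArithmeticFunction ℤ) * χ := by
    rw [hrm.eq_iff_eq_on_prime_powers _ _ (isMultiplicative_zeta.natCast.mul hχm)]
    intro q k hq
    have : Fact q.Prime := ⟨hq⟩
    rw [coe_zeta_mul_apply, Nat.sum_divisors_prime_pow hq, hr (pow_ne_zero k hq.ne_zero),
      card_absNorm_eq_prime_pow hR hq, card_absNorm_eq_prime hq,
      card_ringHom_of_quadraticBasis b h0 h1, card_roots_eq_quadraticChar_add_one hpc]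
    refine Finset.sum_congr rfl fun i _ ↦ ?_
    rw [hχ (pow_ne_zero i hq.ne_zero), Nat.cast_pow, map_pow, add_sub_cancel_right]
  rw [← hr hn, key, coe_zeta_mul_apply]
  exact Finset.sum_congr rfl fun d hd ↦ hχ (Nat.pos_of_mem_divisors hd).ne'

end Factorization

section ClassNumber

open NumberField Filter Topology

variable {K : Type*} [Field K] [NumberField K] {p c : ℕ} [Fact p.Prime]
  (b : Module.Basis (Fin 2) ℤ (𝓞 K))

lemma dedekindZeta_eq_riemannZeta_mul_LFunction (hpc : p + 1 = 4 * c) (h0 : b 0 = 1)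
    (h1 : b 1 * b 1 = (1 : ℤ) • b 1 + (-c : ℤ) • b 0) {s : ℂ} (hs : 1 < s.re) :
    dedekindZeta K s = riemannZeta s * DirichletCharacter.LFunction
      ((quadraticChar (ZMod p)).ringHomComp (Int.castRingHom ℂ)) s := by
  rw [DirichletCharacter.LFunction_eq_LSeries _ hs, ← LSeries_one_eq_riemannZeta hs,
    ← LSeries_convolution' (LSeriesSummable_one_iff.2 hs)
      (ZMod.LSeriesSummable_of_one_lt_re _ hs)]
  refine LSeries_congr (fun {n} hn ↦ ?_) s
  rw [LSeries.convolution_def]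
  change _ = ∑ x ∈ n.divisorsAntidiagonal,
    (1 : ℕ → ℂ) x.1 * ((quadraticChar (ZMod p)).ringHomComp (Int.castRingHom ℂ)) (x.2 : ZMod p)
  rw [Nat.sum_divisorsAntidiagonal' fun m d ↦ (1 : ℕ → ℂ) m *
    ((quadraticChar (ZMod p)).ringHomComp (Int.castRingHom ℂ)) (d : ZMod p)]
  have h := congrArg (Int.cast : ℤ → ℂ) (card_absNorm_eq_sum_quadraticChar b hpc h0 h1 hn)
  push_cast at h
  simp [h]

lemma dedekindZeta_residue_eq_LFunction_one (hpc : p + 1 = 4 * c) (h0 : b 0 = 1)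
    (h1 : b 1 * b 1 = (1 : ℤ) • b 1 + (-c : ℤ) • b 0) :
    (dedekindZeta_residue K : ℂ) = DirichletCharacter.LFunction
      ((quadraticChar (ZMod p)).ringHomComp (Int.castRingHom ℂ)) 1 := by
  have hχ : (quadraticChar (ZMod p)).ringHomComp (Int.castRingHom ℂ) ≠ 1 := by
    rw [MulChar.ringHomComp_ne_one_iff (RingHom.injective_int _)]
    exact quadraticChar_ne_one (by rw [ZMod.ringChar_zmod_n]; lia)
  have hmap : Tendsto (fun s : ℝ ↦ (s : ℂ)) (𝓝[>] 1) (𝓝[≠] 1) := by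
    refine tendsto_nhdsWithin_iff.2 ⟨?_, ?_⟩
    · exact (Complex.continuous_ofReal.tendsto' 1 1 Complex.ofReal_one).mono_left
        nhdsWithin_le_nhds
    · filter_upwards [self_mem_nhdsWithin] with s hs
      simpa using (ne_of_gt hs : s ≠ 1)
  have hL := ((DirichletCharacter.differentiable_LFunction hχ).continuous.tendsto 1).mono_left
    (nhdsWithin_le_nhds (s := {1}ᶜ))
  have hlim := (riemannZeta_residue_one.mul hL).comp hmap
  rw [one_mul] at hlim
  refine tendsto_nhds_unique (tendsto_sub_one_mul_dedekindZeta_nhdsGT K) (hlim.congr' ?_)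
  filter_upwards [self_mem_nhdsWithin] with s hs
  rw [dedekindZeta_eq_riemannZeta_mul_LFunction b hpc h0 h1 (by simpa using hs)]
  simp [mul_assoc]

end ClassNumber

open NumberField in
/-- **Dirichlet's class number formula** for `ℚ(√-p)`, `p ≡ 3 (mod 4)`, in closed form. -/
lemma classNumber_mul_two_sub_quadraticChar {K : Type*} [Field K] [NumberField K] {α : K}
    {p n : ℕ} [Fact p.Prime] (hpn : p = 2 * n + 1) (hodd : Odd n) (hp3 : 3 < p)
    (hα : α ^ 2 = -(p : K)) (hK : ∀ x : K, ∃ a b : ℚ, x = (a : K) + (b : K) * α) :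
    (classNumber K : ℤ) * (2 - quadraticChar (ZMod p) 2) =
      ∑ k ∈ Finset.range n, quadraticChar (ZMod p) ((k + 1 : ℕ) : ZMod p) := by
  have hp : p.Prime := Fact.out
  obtain ⟨c, hpc⟩ : ∃ c, p + 1 = 4 * c := by
    obtain ⟨m, rfl⟩ := hodd
    exact ⟨m + 1, by lia⟩
  obtain ⟨b, h0, h1⟩ := exists_integralBasis_of_sq_eq_neg hp hpc hα hK
  have hres := dedekindZeta_residue_eq_LFunction_one b hpc h0 h1
  rw [LFunction_quadraticChar_one hpn hodd,
    dedekindZeta_residue_of_sq_eq_neg b (by lia) hpc hα h0 h1] at hres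
  have hS := sum_quadraticChar_mul_val hpn hodd
  set M := ∑ k : ZMod p, quadraticChar (ZMod p) k * (k.val : ℤ)
  have hp0 : (p : ℝ) ≠ 0 := Nat.cast_ne_zero.2 hp.ne_zero
  have hs0 : √(p : ℝ) ≠ 0 := (Real.sqrt_pos.2 (Nat.cast_pos.2 hp.pos)).ne'
  have hM : (p : ℤ) * classNumber K = -M := by
    have h : Real.pi * classNumber K / √(p : ℝ) = -(Real.pi / (p * √(p : ℝ))) * (M : ℝ) := by
      exact_mod_cast hres
    have hpi := Real.pi_ne_zero
    field_simp at h
    have h' : (p : ℝ) * classNumber K = -M := by linear_combination h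
    exact_mod_cast h'
  refine mul_left_cancel₀ (Int.natCast_ne_zero.2 hp.ne_zero) ?_
  linear_combination (2 - quadraticChar (ZMod p) 2) * hM - hS

/-- For a prime `p ≡ 3 (mod 4)`, `p > 3`, with `h` the class number of
`ℚ(√-p)`, and `s_1,…,s_{(p-1)/2}` the nonzero squares of `F_p`, the matrix
`T = [(s_i+s_j)^{p-2} + (s_i-s_j)^{p-2}]` satisfies `det T = (-1)^{(p+3+2h)/4}` in `F_p`. -/
theorem det_T_p_2_r_eq_one (p : ℕ) [Fact p.Prime] (hp : p % 4 = 3) (hp3 : 3 < p)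
    (K : Type*) [Field K] [NumberField K] (α : K) (hα : α ^ 2 = -(p : K))
    (hK : ∀ x : K, ∃ a b : ℚ, x = (a : K) + (b : K) * α)
    (s : Fin ((p - 1) / 2) → ZMod p) (hs : Function.Injective s)
    (hsimg : ∀ x : ZMod p, (∃ i, s i = x) ↔ ∃ y : ZMod p, y ≠ 0 ∧ y ^ 2 = x) :
    (Matrix.of fun i j => (s i + s j) ^ (p - 2) + (s i - s j) ^ (p - 2)).det
      = (-1 : ZMod p) ^ ((p + 3 + 2 * NumberField.classNumber K) / 4) := by
  have hpn : p = 2 * ((p - 1) / 2) + 1 := by lia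
  have hodd : Odd ((p - 1) / 2) := ⟨(p - 3) / 4, by lia⟩
  rw [det_squares_matrix hpn hodd s hs hsimg,
    two_pow_mul_factorial_eq_of_classNumber_formula hpn hodd
      (classNumber_mul_two_sub_quadraticChar hpn hodd hp3 hα hK)]
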